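/- For every δ ≥ 0 there exists λ > 0 such that for every bounded open convex set C ⊂ ℝⁿ whose Hilbert metric space (C, d_C) is δ-hyperbolic, and for every affine plane H ⊂ ℝⁿ with H ∩ C ≠ ∅, one has λ₁(C ∩ H) ≥ λ. -/

import Mathlib

open MeasureTheory Set Filter
open scoped ENNReal NNReal

noncomputable section

/-- Euclidean `n`-space. -/
abbrev Euc (n : ℕ) : Type := EuclideanSpace ℝ (Fin n)

/-- The set of parameters `t` such that `p + t • v` lies in `C`. For `C` open bounded
convex, `p ∈ C` and `v ≠ 0` this is an open interval `(t⁻, t⁺)` with `t⁻ < 0 < t⁺`;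
the points `p + t⁻ • v` and `p + t⁺ • v` are the two intersections of the boundary `∂C`
with the line through `p` directed by `v`. -/
def lineParams {n : ℕ} (C : Set (Euc n)) (p v : Euc n) : Set ℝ := {t : ℝ | p + t • v ∈ C}

open Classical in
/-- The Hilbert distance of the convex set `C`: with `a = p + t⁻ • (q - p)` and
`b = p + t⁺ • (q - p)` the two boundary points (so that `a, p, q, b` are in this order),
the cross-ratio `(‖q-a‖ ‖p-b‖)/(‖p-a‖ ‖q-b‖)` equals `((1 - t⁻) t⁺)/((-t⁻)(t⁺ - 1))`. -/
def hDist {n : ℕ} (C : Set (Euc n)) (p q : Euc n) : ℝ :=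
  if p = q then 0
  else
    (1 / 2) * Real.log
      (((1 - sInf (lineParams C p (q - p))) * sSup (lineParams C p (q - p))) /
        ((-sInf (lineParams C p (q - p))) * (sSup (lineParams C p (q - p)) - 1)))

open Classical in
/-- The Hilbert Finsler norm of `u` at `p`: with `p⁺ = p + t⁺ • u`, `p⁻ = p + t⁻ • u`
the two boundary points on the line through `p` directed by `u`, one has
`(1/2)‖u‖(1/‖p-p⁺‖ + 1/‖p-p⁻‖) = (1/2)(1/t⁺ - 1/t⁻)`. -/
def fNorm {n : ℕ} (C : Set (Euc n)) (p u : Euc n) : ℝ :=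
  if u = 0 then 0
  else (1 / 2) * (1 / sSup (lineParams C p u) - 1 / sInf (lineParams C p u))

/-- The dual norm of a linear form `l` at `p`: `sup {l u : ‖u‖_{C,p} = 1}`. -/
def dualNorm {n : ℕ} (C : Set (Euc n)) (p : Euc n) (l : Euc n →L[ℝ] ℝ) : ℝ :=
  sSup ((fun u => l u) '' {u : Euc n | fNorm C p u = 1})

/-- The tangent ball `TB_R(p) = {u : ‖u‖_{C,p} < R}`. -/
def tangentBall {n : ℕ} (C : Set (Euc n)) (p : Euc n) (R : ℝ) : Set (Euc n) :=
  {u : Euc n | fNorm C p u < R}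

/-- `ωₙ`, the Lebesgue volume of the Euclidean unit ball of `ℝⁿ`. -/
def omegaVol (n : ℕ) : ℝ := (volume (Metric.ball (0 : Euc n) 1)).toReal

/-- The Hilbert (Busemann) measure of `C`: density `ωₙ / vol_e(TB_C(p))` against
Lebesgue measure, supported on `C`. -/
def hMeasure {n : ℕ} (C : Set (Euc n)) : Measure (Euc n) :=
  (volume.restrict C).withDensity fun p =>
    ENNReal.ofReal (omegaVol n / (volume (tangentBall C p 1)).toReal)

/-- Admissible test functions: nonzero Lipschitz functions with compact support
contained in `Ω`. -/
def testFuns {n : ℕ} (Ω : Set (Euc n)) : Set (Euc n → ℝ) :=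
  {f : Euc n → ℝ |
    (∃ K : ℝ≥0, LipschitzWith K f) ∧ f ≠ 0 ∧ HasCompactSupport f ∧ tsupport f ⊆ Ω}

/-- The Rayleigh quotient of `f` on `Ω`, with respect to the Hilbert geometry of `C`
(`df` is the a.e.-defined differential of the Lipschitz function `f`). -/
def rayleigh {n : ℕ} (C Ω : Set (Euc n)) (f : Euc n → ℝ) : ℝ :=
  (∫ p in Ω, dualNorm C p (fderiv ℝ f p) ^ 2 ∂hMeasure C) /
    ∫ p in Ω, f p ^ 2 ∂hMeasure C

/-- The Dirichlet bottom of the spectrum `λ₁^C(Ω)`. -/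
def lambda1D {n : ℕ} (C Ω : Set (Euc n)) : ℝ := sInf (rayleigh C Ω '' testFuns Ω)

/-- The bottom of the spectrum `λ₁(C)` of the Hilbert geometry of `C`. -/
def lambda1 {n : ℕ} (C : Set (Euc n)) : ℝ := lambda1D C C

/-- The Gromov product `(x|y)_t = (d(x,t) + d(y,t) - d(x,y))/2`. -/
def gromovProd {n : ℕ} (d : Euc n → Euc n → ℝ) (x y t : Euc n) : ℝ :=
  (d x t + d y t - d x y) / 2

/-- `(C, d_C)` is `δ`-hyperbolic: for all `x y z t` in `C`,
`(x|y)_t ≥ min((x|z)_t, (y|z)_t) - δ`. -/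
def IsDeltaHyp {n : ℕ} (C : Set (Euc n)) (δ : ℝ) : Prop :=
  ∀ x ∈ C, ∀ y ∈ C, ∀ z ∈ C, ∀ t ∈ C,
    gromovProd (hDist C) x y t ≥
      min (gromovProd (hDist C) x z t) (gromovProd (hDist C) y z t) - δ

/-- The metric ball `B_R(x)` of the Hilbert metric of `C`. -/
def hBall {n : ℕ} (C : Set (Euc n)) (x : Euc n) (R : ℝ) : Set (Euc n) :=
  {y ∈ C | hDist C x y < R}

/-- The image of `C` under the homothety of center `P₀` and ratio `r`. -/
def homoth {n : ℕ} (P₀ : Euc n) (r : ℝ) (C : Set (Euc n)) : Set (Euc n) :=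
  (fun x => P₀ + r • (x - P₀)) '' C

/-- Diameter of a set with respect to a distance function `d`. -/
def ediamD {α : Type*} (d : α → α → ℝ) (S : Set α) : ℝ≥0∞ :=
  ⨆ x ∈ S, ⨆ y ∈ S, ENNReal.ofReal (d x y)

/-- The `k`-dimensional Hausdorff measure of `S` with respect to the distance
function `d`. -/
def hausD {α : Type*} (k : ℝ) (d : α → α → ℝ) (S : Set α) : ℝ≥0∞ :=
  ⨆ (ε : ℝ≥0∞) (_ : 0 < ε),
    ⨅ (U : ℕ → Set α) (_ : S ⊆ ⋃ i, U i) (_ : ∀ i, ediamD d (U i) ≤ ε),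
      ∑' i, ediamD d (U i) ^ k

/-- The frontier of `U` is a rectifiable closed curve (for the Hilbert metric of `C`):
it is the image of a closed continuous curve and has finite one-dimensional Hausdorff
measure. -/
def RectCurveBoundary (C U : Set (Euc 2)) : Prop :=
  ∃ c : ℝ → Euc 2, ContinuousOn c (Icc 0 1) ∧ c '' Icc (0 : ℝ) 1 = frontier U ∧
    c 0 = c 1 ∧ hausD 1 (hDist C) (frontier U) < ⊤

/-- The Cheeger constant `I_∞^C(Ω)` in dimension `2`: infimum of
`ν_C(∂U)/μ_C(U)` over open sets `U` with closure contained in `Ω` whose boundary is a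
rectifiable curve, `ν_C` being the `1`-dimensional Hausdorff measure of `(C, d_C)`. -/
def cheeger2D (C Ω : Set (Euc 2)) : ℝ :=
  sInf {r : ℝ | ∃ U : Set (Euc 2), IsOpen U ∧ U.Nonempty ∧ closure U ⊆ Ω ∧
    RectCurveBoundary C U ∧
    r = (hausD 1 (hDist C) (frontier U)).toReal / (hMeasure C U).toReal}

/-- The Cheeger constant `I_∞(C)` of a planar Hilbert geometry. -/
def cheeger2 (C : Set (Euc 2)) : ℝ := cheeger2D C C

/-- `S` is a `C¹` hypersurface: near each of its points it is the zero set of a `C¹`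
function with nonvanishing differential. -/
def IsC1Hypersurface {n : ℕ} (S : Set (Euc n)) : Prop :=
  ∀ x ∈ S, ∃ (f : Euc n → ℝ) (U : Set (Euc n)), U ∈ nhds x ∧ ContDiffOn ℝ 1 f U ∧
    (∀ y ∈ U, fderiv ℝ f y ≠ 0) ∧ S ∩ U = {y ∈ U | f y = 0}

/-- The Cheeger constant `I_∞^C(Ω)` in dimension `n`: infimum of `ν_C(∂U)/μ_C(U)` over
open sets `U` with closure contained in `Ω` whose boundary is a `C¹` hypersurface,
`ν_C` being the `(n-1)`-dimensional Hausdorff measure of `(C, d_C)`. -/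
def cheegerND {n : ℕ} (C Ω : Set (Euc n)) : ℝ :=
  sInf {r : ℝ | ∃ U : Set (Euc n), IsOpen U ∧ U.Nonempty ∧ closure U ⊆ Ω ∧
    IsC1Hypersurface (frontier U) ∧
    r = (hausD ((n : ℝ) - 1) (hDist C) (frontier U)).toReal / (hMeasure C U).toReal}

/-- The boundary of the convex set `C` is of class `C¹`: through each boundary point
passes a unique supporting hyperplane. -/
def HasC1Boundary {n : ℕ} (C : Set (Euc n)) : Prop :=
  ∀ x ∈ frontier C, ∃! l : Euc n →L[ℝ] ℝ, ‖l‖ = 1 ∧ ∀ y ∈ C, l y ≤ l x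

/-- The convex set `C` is strictly convex: the open segment joining two distinct
boundary points is contained in `C`. -/
def IsStrictlyConvexSet {n : ℕ} (C : Set (Euc n)) : Prop :=
  ∀ x ∈ frontier C, ∀ y ∈ frontier C, x ≠ y → openSegment ℝ x y ⊆ C

end

/-- The gauge of `D - p`. -/
noncomputable def gg {n : ℕ} (D : Set (Euc n)) (p u : Euc n) : ℝ := gauge {v | p + v ∈ D} u

structure GoodD {n : ℕ} (D : Set (Euc n)) : Prop where
  cvx : Convex ℝ D
  opn : IsOpen D
  bdd : Bornology.IsBounded D

section basics
variable {n : ℕ} {D : Set (Euc n)} {p : Euc n}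

lemma shift_cvx (hD : GoodD D) (p : Euc n) : Convex ℝ {v | p + v ∈ D} := by
  have := hD.cvx.translate_preimage_right p
  exact this

lemma shift_open (hD : GoodD D) (p : Euc n) : IsOpen {v | p + v ∈ D} :=
  hD.opn.preimage (continuous_const.add continuous_id)

lemma shift_nhds (hD : GoodD D) (hp : p ∈ D) : {v | p + v ∈ D} ∈ nhds (0 : Euc n) :=
  (shift_open hD p).mem_nhds (by simpa using hp)

lemma shift_bdd (hD : GoodD D) (p : Euc n) : Bornology.IsBounded {v | p + v ∈ D} := by
  obtain ⟨r, hr⟩ := hD.bdd.subset_closedBall p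
  refine (Metric.isBounded_closedBall (x := (0 : Euc n)) (r := r)).subset ?_
  intro v hv
  have := hr hv
  simpa [Metric.mem_closedBall, dist_eq_norm] using this

lemma gg_nonneg (u : Euc n) : 0 ≤ gg D p u := gauge_nonneg _

lemma gg_zero : gg D p 0 = 0 := gauge_zero

lemma gg_smul {s : ℝ} (hs : 0 ≤ s) (u : Euc n) : gg D p (s • u) = s * gg D p u := by
  unfold gg
  rw [gauge_smul_of_nonneg hs]; rfl

lemma gg_add_le (hD : GoodD D) (hp : p ∈ D) (u v : Euc n) :
    gg D p (u + v) ≤ gg D p u + gg D p v :=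
  gauge_add_le (shift_cvx hD p) (absorbent_nhds_zero (shift_nhds hD hp)) u v

lemma gg_continuous (hD : GoodD D) (hp : p ∈ D) : Continuous (gg D p) :=
  continuous_gauge (shift_cvx hD p) (shift_nhds hD hp)

lemma gg_lt_one (hD : GoodD D) (hp : p ∈ D) (u : Euc n) : gg D p u < 1 ↔ p + u ∈ D := by
  have := gauge_lt_one_iff_mem_interior (x := u) (shift_cvx hD p) (shift_nhds hD hp)
  rw [(shift_open hD p).interior_eq] at this
  exact this

lemma gg_lt_iff (hD : GoodD D) (hp : p ∈ D) (u : Euc n) {c : ℝ} (hc : 0 < c) :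
    gg D p u < c ↔ p + c⁻¹ • u ∈ D := by
  rw [← gg_lt_one hD hp, gg_smul (by positivity), inv_mul_lt_iff₀ hc, mul_one]

lemma closure_shift (p u : Euc n) : u ∈ closure {v | p + v ∈ D} ↔ p + u ∈ closure D := by
  have : {v | p + v ∈ D} = (Homeomorph.addLeft p) ⁻¹' D := rfl
  rw [this, ← Homeomorph.preimage_closure]; rfl

lemma gg_le_one (hD : GoodD D) (hp : p ∈ D) (u : Euc n) : gg D p u ≤ 1 ↔ p + u ∈ closure D := by
  rw [← closure_shift]
  exact gauge_le_one_iff_mem_closure (shift_cvx hD p) (shift_nhds hD hp)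

lemma gg_pos (hD : GoodD D) (hp : p ∈ D) {u : Euc n} (hu : u ≠ 0) : 0 < gg D p u := by
  refine (gauge_pos (absorbent_nhds_zero (shift_nhds hD hp)) ?_).2 hu
  exact (NormedSpace.isVonNBounded_iff ℝ).2 (shift_bdd hD p)

lemma lineParams_eq (hD : GoodD D) (hp : p ∈ D) {u : Euc n} (hu : u ≠ 0) :
    lineParams D p u = Ioo (-(gg D p (-u))⁻¹) ((gg D p u)⁻¹) := by
  have h1 := gg_pos hD hp hu
  have h2 := gg_pos hD hp (neg_ne_zero.2 hu)
  ext t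
  simp only [lineParams, mem_ofPred_eq, mem_Ioo]
  rw [← gg_lt_one hD hp]
  rcases le_total 0 t with ht | ht
  · rw [gg_smul ht]
    constructor
    · intro h
      refine ⟨lt_of_lt_of_le (neg_lt_zero.2 (inv_pos.2 h2)) ht, ?_⟩
      rw [← one_div, lt_div_iff₀ h1]; exact h
    · rintro ⟨-, h⟩
      rw [← one_div, lt_div_iff₀ h1] at h; exact h
  · have : t • u = (-t) • (-u) := by simp
    rw [this, gg_smul (by linarith)]
    constructor
    · intro h
      refine ⟨?_, lt_of_le_of_lt ht (inv_pos.2 h1)⟩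
      rw [neg_lt, ← one_div, lt_div_iff₀ h2]; exact h
    · rintro ⟨h, -⟩
      rw [neg_lt, ← one_div, lt_div_iff₀ h2] at h; exact h

lemma sSup_lp (hD : GoodD D) (hp : p ∈ D) {u : Euc n} (hu : u ≠ 0) :
    sSup (lineParams D p u) = (gg D p u)⁻¹ := by
  have h1 := gg_pos hD hp hu
  have h2 := gg_pos hD hp (neg_ne_zero.2 hu)
  rw [lineParams_eq hD hp hu, csSup_Ioo]
  have := inv_pos.2 h1; have := inv_pos.2 h2; linarith

lemma sInf_lp (hD : GoodD D) (hp : p ∈ D) {u : Euc n} (hu : u ≠ 0) :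
    sInf (lineParams D p u) = -(gg D p (-u))⁻¹ := by
  have h1 := gg_pos hD hp hu
  have h2 := gg_pos hD hp (neg_ne_zero.2 hu)
  rw [lineParams_eq hD hp hu, csInf_Ioo]
  have := inv_pos.2 h1; have := inv_pos.2 h2; linarith

lemma fNorm_eq (hD : GoodD D) (hp : p ∈ D) (u : Euc n) :
    fNorm D p u = (1 / 2) * (gg D p u + gg D p (-u)) := by
  unfold fNorm
  split_ifs with h
  · simp [h, gg_zero]
  · rw [sSup_lp hD hp h, sInf_lp hD hp h]; simp

lemma hDist_eq (hD : GoodD D) (hp : p ∈ D) {q : Euc n} (hq : q ∈ D) :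
    hDist D p q = (1 / 2) * Real.log ((1 + gg D p (p - q)) / (1 - gg D p (q - p))) := by
  unfold hDist
  split_ifs with h
  · simp [h, gg_zero]
  · have hv : q - p ≠ 0 := sub_ne_zero.2 (Ne.symm h)
    have h1 := gg_pos hD hp hv
    have h2 := gg_pos hD hp (neg_ne_zero.2 hv)
    have h3 : gg D p (q - p) < 1 := by rw [gg_lt_one hD hp]; simpa using hq
    rw [sSup_lp hD hp hv, sInf_lp hD hp hv]
    rw [neg_sub] at *
    congr 2
    have : 1 - gg D p (q - p) ≠ 0 := by linarith
    have h4 : (gg D p (q - p))⁻¹ - 1 ≠ 0 := by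
      have := (one_lt_inv₀ h1).2 h3; linarith
    field_simp
    ring

/-- lower bound of the Hilbert distance by positive affine functions -/
lemma hDist_lower (hD : GoodD D) (hp : p ∈ D) {q : Euc n} (hq : q ∈ D)
    (f f' : Euc n →ᵃ[ℝ] ℝ) (hf : ∀ z ∈ D, 0 < f z) (hf' : ∀ z ∈ D, 0 < f' z) {M : ℝ}
    (hM0 : 0 < M) (hM : M * (f q * f' p) ≤ f p * f' q) :
    (1 / 2) * Real.log M ≤ hDist D p q := by
  rw [hDist_eq hD hp hq]
  have h3 : gg D p (q - p) < 1 := by rw [gg_lt_one hD hp]; simpa using hq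
  have h4 : 0 ≤ gg D p (p - q) := gg_nonneg _
  -- general fact
  have key : ∀ (k : Euc n →ᵃ[ℝ] ℝ), (∀ z ∈ D, 0 < k z) → ∀ v, - k.linear v ≤ k p * gg D p v := by
    intro k hk v
    refine le_of_forall_gt_imp_ge_of_dense ?_
    intro c hc
    have hkp := hk p hp
    have hc' : gg D p v < c / k p := by rwa [lt_div_iff₀ hkp, mul_comm]
    have hcpos : 0 < c / k p := lt_of_le_of_lt (gg_nonneg _) hc'
    rw [gg_lt_iff hD hp v hcpos] at hc'
    have := hk _ hc'
    have e : k (p + (c / k p)⁻¹ • v) = k p + (c / k p)⁻¹ * k.linear v := by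
      have := k.map_vadd p ((c / k p)⁻¹ • v)
      rw [vadd_eq_add, vadd_eq_add, add_comm] at this
      rw [this]; simp [add_comm]
    rw [e] at this
    have hcp : 0 < c := by
      have := mul_pos hcpos hkp
      rwa [div_mul_cancel₀ _ hkp.ne'] at this
    have h5 : (c / k p)⁻¹ = k p / c := by rw [inv_div]
    rw [h5] at this
    have : 0 < k p * (c + k.linear v) / c := by
      have e2 : k p * (c + k.linear v) / c = k p + k p / c * k.linear v := by field_simp
      rw [e2]; exact this
    have h6 : 0 < k p * (c + k.linear v) := by
      by_contra hcon
      have := div_nonpos_of_nonpos_of_nonneg (not_lt.1 hcon) hcp.le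
      linarith
    have := pos_of_mul_pos_right h6 hkp.le
    linarith
  have e1 : ∀ k : Euc n →ᵃ[ℝ] ℝ, k.linear (q - p) = k q - k p := by
    intro k
    have := k.linearMap_vsub q p
    simpa using this
  have e2 : ∀ k : Euc n →ᵃ[ℝ] ℝ, k.linear (p - q) = k p - k q := by
    intro k
    have := k.linearMap_vsub p q
    simpa using this
  have a1 := key f hf (q - p)
  have a2 := key f' hf' (p - q)
  rw [e1] at a1; rw [e2] at a2
  have b1 : f p * (1 - gg D p (q - p)) ≤ f q := by linarith
  have b2 : f' q ≤ f' p * (1 + gg D p (p - q)) := by linarith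
  have c1 := hf p hp
  have c2 := hf' p hp
  have c3 := hf q hq
  have : M ≤ (1 + gg D p (p - q)) / (1 - gg D p (q - p)) := by
    rw [le_div_iff₀ (by linarith)]
    have s1 : M * (f p * (1 - gg D p (q - p)) * f' p) ≤ M * (f q * f' p) := by gcongr
    have s2 : f p * f' q ≤ f p * (f' p * (1 + gg D p (p - q))) := by gcongr
    have s3 : (f p * f' p) * (M * (1 - gg D p (q - p))) ≤ (f p * f' p) * (1 + gg D p (p - q)) := by
      nlinarith
    exact le_of_mul_le_mul_left s3 (by positivity)
  have := Real.log_le_log hM0 this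
  linarith

lemma hDist_upper (hD : GoodD D) (hp : p ∈ D) {q v v' : Euc n} (hq : q ∈ D)
    (hv : v ∈ closure D) (hv' : v' ∈ closure D) {T1 T2 S S' l l' : ℝ}
    (hT1 : 0 < T1) (hT2 : 0 < T2) (hS : 0 ≤ S) (hS' : 0 ≤ S')
    (m1 : l' * T1 = T2 + S) (m2 : l * T2 = T1 + S')
    (e1 : (l' * T1) • p = T2 • q + S • v) (e2 : (l * T2) • q = T1 • p + S' • v') :
    hDist D p q ≤ (1 / 2) * Real.log (l * l') := by
  rw [hDist_eq hD hp hq]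
  have h3 : gg D p (q - p) < 1 := by rw [gg_lt_one hD hp]; simpa using hq
  have h4 : 0 ≤ gg D p (p - q) := gg_nonneg _
  have hl : 0 < l := by
    by_contra h
    have : l * T2 ≤ 0 := mul_nonpos_of_nonpos_of_nonneg (not_lt.1 h) hT2.le
    linarith
  have hl' : 0 < l' := by
    by_contra h
    have : l' * T1 ≤ 0 := mul_nonpos_of_nonpos_of_nonneg (not_lt.1 h) hT1.le
    linarith
  have f1 : p - q = (S / T2) • (v - p) := by
    have : T2 • (p - q) = S • (v - p) := by
      have : (T2 + S) • p = T2 • q + S • v := by rw [← m1]; exact e1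
      rw [add_smul] at this
      rw [smul_sub, smul_sub, sub_eq_sub_iff_add_eq_add, this, add_comm]
    rw [div_eq_inv_mul, mul_smul, ← this, smul_smul, inv_mul_cancel₀ hT2.ne', one_smul]
  have f2 : q - p = (S' / (l * T2)) • (v' - p) := by
    have : (l * T2) • (q - p) = S' • (v' - p) := by
      rw [smul_sub, smul_sub, e2, m2, add_smul]; abel
    rw [div_eq_inv_mul, mul_smul, ← this, smul_smul, inv_mul_cancel₀ (by positivity), one_smul]
  have g1 : gg D p (p - q) ≤ S / T2 := by
    rw [f1, gg_smul (by positivity)]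
    have := (gg_le_one hD hp (v - p)).2 (by simpa using hv)
    have h5 : 0 ≤ S / T2 := by positivity
    nlinarith
  have g2 : gg D p (q - p) ≤ S' / (l * T2) := by
    rw [f2, gg_smul (by positivity)]
    have := (gg_le_one hD hp (v' - p)).2 (by simpa using hv')
    have h5 : 0 ≤ S' / (l * T2) := by positivity
    nlinarith
  have k1 : 1 + gg D p (p - q) ≤ l' * T1 / T2 := by
    have : l' * T1 / T2 = 1 + S / T2 := by rw [m1]; field_simp
    linarith
  have k2 : T1 / (l * T2) ≤ 1 - gg D p (q - p) := by
    have : T1 / (l * T2) = 1 - S' / (l * T2) := by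
      have : T1 = l * T2 - S' := by linarith
      rw [this]; field_simp
    linarith
  have : (1 + gg D p (p - q)) / (1 - gg D p (q - p)) ≤ l * l' := by
    rw [div_le_iff₀ (by linarith)]
    calc 1 + gg D p (p - q) ≤ l' * T1 / T2 := k1
      _ = l * l' * (T1 / (l * T2)) := by field_simp
      _ ≤ _ := by gcongr
  have := Real.log_le_log (by apply div_pos <;> linarith) this
  linarith

end basics

section corner
variable {n : ℕ} {D : Set (Euc n)}

noncomputable def zp (o p b : Euc n) (k P Q : ℝ) : Euc n :=
  (k / (k + P + Q)) • o + (P / (k + P + Q)) • p + (Q / (k + P + Q)) • b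

lemma aff_comb3 (f : Euc n →ᵃ[ℝ] ℝ) {a b c : ℝ} (h : a + b + c = 1) (x y z : Euc n) :
    f (a • x + b • y + c • z) = a * f x + b * f y + c * f z := by
  have h1 : ∀ w, f w = f.linear w + f 0 := fun w => by
    have := congrFun f.decomp w; simpa using this
  rw [h1 (a • x + b • y + c • z), h1 x, h1 y, h1 z]
  simp only [map_add, map_smul, smul_eq_mul]
  linear_combination (-f 0) * h

lemma zp_aff (f : Euc n →ᵃ[ℝ] ℝ) {o p b : Euc n} {k P Q : ℝ} (hk : 0 < k) (hP : 0 < P)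
    (hQ : 0 < Q) : f (zp o p b k P Q) = (k * f o + P * f p + Q * f b) / (k + P + Q) := by
  unfold zp
  rw [aff_comb3 f (by field_simp)]
  field_simp

lemma zp_mem (hD : GoodD D) {o p b : Euc n} (hp : p ∈ D) (ho : o ∈ closure D)
    (hb : b ∈ closure D) {k P Q : ℝ} (hk : 0 < k) (hP : 0 < P) (hQ : 0 < Q) :
    zp o p b k P Q ∈ D := by
  have hw : (k / (k + Q)) • o + (Q / (k + Q)) • b ∈ closure D :=
    hD.cvx.closure ho hb (by positivity) (by positivity) (by field_simp)
  have := hD.cvx.combo_interior_closure_mem_interior (x := p) (by rwa [hD.opn.interior_eq]) hw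
    (a := P / (k + P + Q)) (b := (k + Q) / (k + P + Q)) (by positivity) (by positivity)
    (by field_simp; ring)
  rw [hD.opn.interior_eq] at this
  convert this using 1
  unfold zp
  rw [smul_add, smul_smul, smul_smul]
  have e1 : (k + Q) / (k + P + Q) * (k / (k + Q)) = k / (k + P + Q) := by field_simp
  have e2 : (k + Q) / (k + P + Q) * (Q / (k + Q)) = Q / (k + P + Q) := by field_simp
  rw [e1, e2]; abel

lemma zp_smul (o p b : Euc n) {k P Q : ℝ} (hk : 0 < k) (hP : 0 < P) (hQ : 0 < Q) :
    (k + P + Q) • zp o p b k P Q = k • o + P • p + Q • b := by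
  unfold zp
  have h : k + P + Q ≠ 0 := by positivity
  simp only [smul_add, smul_smul, mul_div_cancel₀ _ h]

lemma hDist_upper' (hD : GoodD D) {p q v v' : Euc n} (hp : p ∈ D) (hq : q ∈ D)
    (hv : v ∈ closure D) (hv' : v' ∈ closure D) {T1 T2 S S' L : ℝ}
    (hT1 : 0 < T1) (hT2 : 0 < T2) (hS : 0 ≤ S) (hS' : 0 ≤ S')
    (m1 : L * T1 = T2 + S) (m2 : T2 = T1 + S')
    (e1 : L • (T1 • p) = T2 • q + S • v) (e2 : T2 • q = T1 • p + S' • v') :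
    hDist D p q ≤ (1 / 2) * Real.log L ∧ hDist D q p ≤ (1 / 2) * Real.log L := by
  constructor
  · have := hDist_upper hD hp hq hv hv' (l := 1) (l' := L) hT1 hT2 hS hS' m1 (by linarith)
      (by rw [← smul_smul]; exact e1) (by rw [one_mul]; exact e2)
    simpa using this
  · have := hDist_upper hD hq hp hv' hv (l := L) (l' := 1) hT2 hT1 hS' hS (by linarith) m1
      (by rw [one_mul]; exact e2) (by rw [← smul_smul]; exact e1)
    simpa using this

lemma zp_distP (hD : GoodD D) {o p b : Euc n} (hp : p ∈ D) (ho : o ∈ closure D)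
    (hb : b ∈ closure D) {k P Q L : ℝ} (hk : 0 < k) (hP : 0 < P) (hQ : 0 < Q) (hL : 1 ≤ L) :
    hDist D (zp o p b k P Q) (zp o p b k (L * P) Q) ≤ (1 / 2) * Real.log L ∧
    hDist D (zp o p b k (L * P) Q) (zp o p b k P Q) ≤ (1 / 2) * Real.log L := by
  have hLP : 0 < L * P := by positivity
  have hw : (k / (k + Q)) • o + (Q / (k + Q)) • b ∈ closure D :=
    hD.cvx.closure ho hb (by positivity) (by positivity) (by field_simp)
  refine hDist_upper' hD (zp_mem hD hp ho hb hk hP hQ) (zp_mem hD hp ho hb hk hLP hQ)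
    hw (subset_closure hp) (T1 := k + P + Q) (T2 := k + L * P + Q) (S := (L - 1) * (k + Q))
    (S' := (L - 1) * P) (by positivity) (by positivity)
    (mul_nonneg (by linarith) (by positivity)) (mul_nonneg (by linarith) (by positivity))
    (by ring) (by ring) ?_ ?_
  · rw [zp_smul o p b hk hP hQ, zp_smul o p b hk hLP hQ]
    have e1 : (L - 1) * (k + Q) * (k / (k + Q)) = (L - 1) * k := by field_simp
    have e2 : (L - 1) * (k + Q) * (Q / (k + Q)) = (L - 1) * Q := by field_simp
    rw [smul_add (_ * _), smul_smul, smul_smul, e1, e2]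
    module
  · rw [zp_smul o p b hk hP hQ, zp_smul o p b hk hLP hQ]
    module

lemma zp_distQ (hD : GoodD D) {o p b : Euc n} (hp : p ∈ D) (ho : o ∈ closure D)
    (hb : b ∈ closure D) {k P Q L : ℝ} (hk : 0 < k) (hP : 0 < P) (hQ : 0 < Q) (hL : 1 ≤ L) :
    hDist D (zp o p b k P Q) (zp o p b k P (L * Q)) ≤ (1 / 2) * Real.log L ∧
    hDist D (zp o p b k P (L * Q)) (zp o p b k P Q) ≤ (1 / 2) * Real.log L := by
  have hLQ : 0 < L * Q := by positivity
  have hw : (k / (k + P)) • o + (P / (k + P)) • p ∈ closure D :=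
    hD.cvx.closure ho (subset_closure hp) (by positivity) (by positivity) (by field_simp)
  refine hDist_upper' hD (zp_mem hD hp ho hb hk hP hQ) (zp_mem hD hp ho hb hk hP hLQ)
    hw hb (T1 := k + P + Q) (T2 := k + P + L * Q) (S := (L - 1) * (k + P))
    (S' := (L - 1) * Q) (by positivity) (by positivity)
    (mul_nonneg (by linarith) (by positivity)) (mul_nonneg (by linarith) (by positivity))
    (by ring) (by ring) ?_ ?_
  · rw [zp_smul o p b hk hP hQ, zp_smul o p b hk hP hLQ]
    have e1 : (L - 1) * (k + P) * (k / (k + P)) = (L - 1) * k := by field_simp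
    have e2 : (L - 1) * (k + P) * (P / (k + P)) = (L - 1) * P := by field_simp
    rw [smul_add (_ * _), smul_smul, smul_smul, e1, e2]
    module
  · rw [zp_smul o p b hk hP hQ, zp_smul o p b hk hP hLQ]
    module

lemma hyp_four {δ : ℝ} (h : IsDeltaHyp D δ) {x y z t : Euc n} (hx : x ∈ D) (hy : y ∈ D)
    (hz : z ∈ D) (ht : t ∈ D) {A : ℝ} (h1 : hDist D x z ≤ A) (h2 : hDist D y t ≤ A)
    (h3 : hDist D y z ≤ A) (h4 : hDist D x t ≤ A) :
    hDist D x y + hDist D z t ≤ 2 * A + 2 * δ := by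
  have := h x hx y hy z hz t ht
  unfold gromovProd at this
  rcases min_cases ((hDist D x t + hDist D z t - hDist D x z) / 2)
    ((hDist D y t + hDist D z t - hDist D y z) / 2) with ⟨e, -⟩ | ⟨e, -⟩ <;> rw [e] at this <;>
    linarith

lemma frac_help {M a b c d T1 T2 : ℝ} (h1 : 0 < T1) (h2 : 0 < T2) (h : M * (a * b) ≤ c * d) :
    M * (a / T2 * (b / T1)) ≤ c / T1 * (d / T2) := by
  have e1 : M * (a / T2 * (b / T1)) = (M * (a * b)) / (T1 * T2) := by field_simp
  have e2 : c / T1 * (d / T2) = (c * d) / (T1 * T2) := by field_simp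
  rw [e1, e2]; gcongr

noncomputable def Lam (δ : ℝ) : ℝ := 81 * Real.exp (4 * δ)

lemma one_lt_Lam {δ : ℝ} (hδ : 0 ≤ δ) : 1 < Lam δ := by
  have := Real.add_one_le_exp (4 * δ)
  unfold Lam; linarith

lemma corner_lemma (hD : GoodD D) {δ : ℝ} (hδ : 0 ≤ δ) (h : IsDeltaHyp D δ) {o p b : Euc n}
    (hp : p ∈ D) (ho : o ∈ closure D) (hb : b ∈ closure D) {f1 f2 f3 : Euc n →ᵃ[ℝ] ℝ}
    (hf1 : ∀ z ∈ D, 0 < f1 z) (hf2 : ∀ z ∈ D, 0 < f2 z) (hf3 : ∀ z ∈ D, 0 < f3 z)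
    (p1 : f1 p = 1) (p2 : f2 p = 1) (p3 : f3 p = 1) {k β : ℝ} (hk : 0 < k) (hβ : 0 ≤ β)
    (o1 : f1 o = β) (o2 : f2 o = β) (o3 : k * f3 o = 1)
    (b1 : f1 b = 0) (b2 : 1 ≤ f2 b) (b2' : f2 b ≤ 2) (b3 : 0 ≤ f3 b) (b3' : f3 b ≤ 3) :
    ((Lam δ) ^ 2)⁻¹ ≤ k * β := by
  by_contra hcon
  push Not at hcon
  set L := Lam δ with hL
  have hL1 : 1 < L := one_lt_Lam hδ
  have hL0 : 0 < L := by linarith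
  set Q1 := L⁻¹ with hQ1
  set P1 := (L ^ 2)⁻¹ with hP1
  have hQ10 : 0 < Q1 := by positivity
  have hP10 : 0 < P1 := by positivity
  have eP : L * P1 = Q1 := by rw [hP1, hQ1]; field_simp
  have eQ : L * Q1 = 1 := by rw [hQ1]; field_simp
  have hQ1lt : Q1 < 1 := inv_lt_one_of_one_lt₀ hL1
  have hPQ : P1 < Q1 := by nlinarith
  have one0 : (0:ℝ) < 1 := one_pos
  have kb : 0 ≤ k * β := by positivity
  -- the four points
  have m11 := zp_mem hD hp ho hb hk hP10 hQ10
  have m22 := zp_mem hD hp ho hb hk hQ10 one0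
  have m12 := zp_mem hD hp ho hb hk hP10 one0
  have m21 := zp_mem hD hp ho hb hk hQ10 hQ10
  have d1 := (zp_distQ hD hp ho hb hk hP10 hQ10 hL1.le).1
  have d2 := (zp_distQ hD hp ho hb hk hQ10 hQ10 hL1.le).2
  have d3 := (zp_distP hD hp ho hb hk hP10 one0 hL1.le).2
  have d4 := (zp_distP hD hp ho hb hk hP10 hQ10 hL1.le).1
  rw [eQ] at d1 d2
  rw [eP] at d3 d4
  have four := hyp_four h m11 m22 m12 m21 d1 d2 d3 d4
  have l1 : (1/2) * Real.log (L / 10) ≤ hDist D (zp o p b k P1 Q1) (zp o p b k Q1 1) := by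
    refine hDist_lower hD m11 m22 f3 f1 hf3 hf1 (by positivity) ?_
    rw [zp_aff f3 hk hQ10 one0, zp_aff f1 hk hP10 hQ10, zp_aff f3 hk hP10 hQ10,
      zp_aff f1 hk hQ10 one0, o1, o3, p1, p3, b1]
    refine frac_help (by positivity) (by positivity) ?_
    have : L / 10 * ((1 + Q1 * 1 + 1 * f3 b) * (k * β + P1 * 1 + Q1 * 0))
        ≤ L / 10 * ((1 + 1 * 1 + 1 * 3) * (P1 + P1 * 1 + Q1 * 0)) := by gcongr
    refine this.trans ?_
    have : L / 10 * ((1 + 1 * 1 + 1 * 3) * (P1 + P1 * 1 + Q1 * 0)) = Q1 := by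
      rw [← eP]; ring
    rw [this]
    have := mul_nonneg hQ10.le b3
    nlinarith
  have l2 : (1/2) * Real.log (L ^ 2 / 8) ≤ hDist D (zp o p b k P1 1) (zp o p b k Q1 Q1) := by
    refine hDist_lower hD m12 m21 f2 f1 hf2 hf1 (by positivity) ?_
    rw [zp_aff f2 hk hQ10 hQ10, zp_aff f1 hk hP10 one0, zp_aff f2 hk hP10 one0,
      zp_aff f1 hk hQ10 hQ10, o1, o2, p1, p2, b1]
    refine frac_help (by positivity) (by positivity) ?_
    have : L ^ 2 / 8 * ((k * β + Q1 * 1 + Q1 * f2 b) * (k * β + P1 * 1 + 1 * 0))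
        ≤ L ^ 2 / 8 * ((Q1 + Q1 * 1 + Q1 * 2) * (P1 + P1 * 1 + 1 * 0)) := by
      gcongr
      linarith
    refine this.trans ?_
    have : L ^ 2 / 8 * ((Q1 + Q1 * 1 + Q1 * 2) * (P1 + P1 * 1 + 1 * 0)) = Q1 := by
      have : L ^ 2 * P1 = 1 := by rw [hP1]; field_simp
      linear_combination Q1 * this
    rw [this]
    nlinarith
  have hlog1 : Real.log (L / 10) = Real.log L - Real.log 10 := Real.log_div hL0.ne' (by norm_num)
  have hlog2 : Real.log (L ^ 2 / 8) = 2 * Real.log L - Real.log 8 := by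
    rw [Real.log_div (by positivity) (by norm_num), Real.log_pow]; norm_num
  have hlogL : Real.log L = Real.log 81 + 4 * δ := by
    rw [hL, Lam, Real.log_mul (by norm_num) (Real.exp_ne_zero _), Real.log_exp]
  have h80 : Real.log 10 + Real.log 8 < Real.log 81 := by
    rw [← Real.log_mul (by norm_num) (by norm_num)]
    exact Real.log_lt_log (by norm_num) (by norm_num)
  rw [hlog1] at l1; rw [hlog2] at l2
  linarith

end corner

section opt
variable {n : ℕ} {D : Set (Euc n)}

lemma fN_smul (hD : GoodD D) {p : Euc n} (hp : p ∈ D) {s : ℝ} (hs : 0 ≤ s) (u : Euc n) :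
    fNorm D p (s • u) = s * fNorm D p u := by
  rw [fNorm_eq hD hp, fNorm_eq hD hp, ← smul_neg, gg_smul hs, gg_smul hs]; ring

lemma fN_neg (hD : GoodD D) {p : Euc n} (hp : p ∈ D) (u : Euc n) :
    fNorm D p (-u) = fNorm D p u := by
  rw [fNorm_eq hD hp, fNorm_eq hD hp, neg_neg]; ring

lemma fN_add (hD : GoodD D) {p : Euc n} (hp : p ∈ D) (u v : Euc n) :
    fNorm D p (u + v) ≤ fNorm D p u + fNorm D p v := by
  rw [fNorm_eq hD hp, fNorm_eq hD hp, fNorm_eq hD hp, neg_add]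
  have := gg_add_le hD hp u v
  have := gg_add_le hD hp (-u) (-v)
  linarith

lemma fN_pos (hD : GoodD D) {p : Euc n} (hp : p ∈ D) {u : Euc n} (hu : u ≠ 0) :
    0 < fNorm D p u := by
  rw [fNorm_eq hD hp]
  have := gg_pos hD hp hu
  have := gg_nonneg (D := D) (p := p) (-u)
  linarith

lemma fN_nonneg (hD : GoodD D) {p : Euc n} (hp : p ∈ D) (u : Euc n) :
    0 ≤ fNorm D p u := by
  rw [fNorm_eq hD hp]
  have := gg_nonneg (D := D) (p := p) (u)
  have := gg_nonneg (D := D) (p := p) (-u)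
  linarith

lemma fN_cont (hD : GoodD D) {p : Euc n} (hp : p ∈ D) : Continuous (fNorm D p) := by
  have : fNorm D p = fun u => (1 / 2) * (gg D p u + gg D p (-u)) := funext (fNorm_eq hD hp)
  rw [this]
  have := gg_continuous hD hp
  fun_prop

lemma fN_zero (p : Euc n) : fNorm D p 0 = 0 := by simp [fNorm]

/-- the Finsler norm dominates the euclidean one -/
lemma fN_bound (hD : GoodD D) : ∃ M : ℝ, 0 < M ∧ ∀ p ∈ D, ∀ u, ‖u‖ ≤ M * fNorm D p u := by
  obtain ⟨r, hr⟩ := hD.bdd.closure.subset_closedBall (0 : Euc n)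
  refine ⟨4 * (|r| + 1), by positivity, fun p hp u => ?_⟩
  have hp' := hr (subset_closure hp)
  rcases eq_or_ne u 0 with rfl | hu
  · simp [fN_zero]
  have h1 := gg_pos hD hp hu
  have h2 : p + (gg D p u)⁻¹ • u ∈ closure D := by
    rw [← gg_le_one hD hp, gg_smul (by positivity), inv_mul_cancel₀ h1.ne']
  have h3 := hr h2
  rw [mem_closedBall_zero_iff] at hp' h3
  have h4 : ‖(gg D p u)⁻¹ • u‖ ≤ 2 * (|r| + 1) := by
    have : (gg D p u)⁻¹ • u = (p + (gg D p u)⁻¹ • u) - p := by abel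
    rw [this]
    refine (norm_sub_le _ _).trans ?_
    have := le_abs_self r
    linarith
  rw [norm_smul, Real.norm_of_nonneg (by positivity), inv_mul_le_iff₀ h1] at h4
  rw [fNorm_eq hD hp]
  have := gg_nonneg (D := D) (p := p) (-u)
  have h5 : 0 ≤ |r| := abs_nonneg r
  nlinarith [mul_nonneg h5 this]

/-- `w` is the dual norm of `α` at `p`, attained. -/
def IsW (D : Set (Euc n)) (p : Euc n) (α : Euc n →ₗ[ℝ] ℝ) (w : ℝ) : Prop :=
  0 < w ∧ (∃ u, fNorm D p u = 1 ∧ α u = w) ∧ ∀ v, α v ≤ w * fNorm D p v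

lemma exists_isW (hD : GoodD D) {p : Euc n} (hp : p ∈ D) {α : Euc n →ₗ[ℝ] ℝ} (hα : α ≠ 0) :
    ∃ w, IsW D p α w := by
  obtain ⟨M, hM0, hM⟩ := fN_bound hD
  have hc : IsCompact {u | fNorm D p u ≤ 1} := by
    refine Metric.isCompact_of_isClosed_isBounded (isClosed_le (fN_cont hD hp) continuous_const) ?_
    refine (Metric.isBounded_closedBall (x := (0 : Euc n)) (r := M)).subset ?_
    intro u hu
    rw [mem_closedBall_zero_iff]
    have := hM p hp u
    have hu : fNorm D p u ≤ 1 := hu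
    nlinarith
  obtain ⟨u, hu, hmax⟩ := hc.exists_isMaxOn ⟨0, by simp [fN_zero]⟩
    (LinearMap.continuous_of_finiteDimensional α).continuousOn
  have hu1 : fNorm D p u ≤ 1 := hu
  have hall : ∀ v, α v ≤ α u * fNorm D p v := by
    intro v
    rcases eq_or_ne v 0 with rfl | hv
    · simp [fN_zero]
    have h1 := fN_pos hD hp hv
    have : α ((fNorm D p v)⁻¹ • v) ≤ α u := hmax (by
      change fNorm D p _ ≤ 1
      rw [fN_smul hD hp (by positivity), inv_mul_cancel₀ h1.ne'])
    rw [map_smul, smul_eq_mul, inv_mul_le_iff₀ h1] at this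
    linarith
  have hpos : 0 < α u := by
    obtain ⟨v, hv⟩ : ∃ v, α v ≠ 0 := by
      by_contra hcon
      push Not at hcon
      exact hα (LinearMap.ext hcon)
    by_contra hcon
    have hle : ∀ v, α v ≤ 0 := fun v =>
      (hall v).trans (mul_nonpos_of_nonpos_of_nonneg (not_lt.1 hcon) (fN_nonneg hD hp v))
    have h1 := hle v
    have h2 := hle (-v)
    rw [map_neg] at h2
    exact hv (by linarith)
  refine ⟨α u, hpos, ⟨u, ?_, rfl⟩, hall⟩
  have := hall u
  nlinarith

lemma isW_pair (hD : GoodD D) {p : Euc n} (hp : p ∈ D) {α : Euc n →ₗ[ℝ] ℝ} {w : ℝ}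
    (hw : IsW D p α w) : ∃ A B : Euc n →ₗ[ℝ] ℝ, (∀ v, A v ≤ gg D p v) ∧
      (∀ v, B v ≤ gg D p (-v)) ∧ ∀ v, A v + B v = (2 / w) * α v := by
  obtain ⟨hw0, -, hall⟩ := hw
  let f : (Euc n × Euc n) →ₗ.[ℝ] ℝ :=
    ⟨LinearMap.ker (LinearMap.fst ℝ (Euc n) (Euc n) - LinearMap.snd ℝ (Euc n) (Euc n)),
      (((2 / w) • α) ∘ₗ LinearMap.fst ℝ (Euc n) (Euc n)) ∘ₗ Submodule.subtype _⟩
  obtain ⟨G, hG1, hG2⟩ := exists_extension_of_le_sublinear f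
    (fun x => gg D p x.1 + gg D p (-x.2)) (by
      intro c hc x
      simp only [Prod.smul_fst, Prod.smul_snd]
      rw [← smul_neg, gg_smul hc.le, gg_smul hc.le]; ring) (by
      intro x y
      simp only [Prod.fst_add, Prod.snd_add, neg_add]
      have := gg_add_le hD hp x.1 y.1
      have := gg_add_le hD hp (-x.2) (-y.2)
      linarith) (by
      rintro ⟨⟨x, y⟩, hxy⟩
      have hxy' : x = y := by
        have : x - y = 0 := hxy
        exact sub_eq_zero.1 this
      subst hxy'
      change (2 / w) * α x ≤ gg D p x + gg D p (-x)
      have := hall x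
      rw [fNorm_eq hD hp] at this
      rw [div_mul_eq_mul_div, div_le_iff₀ hw0]
      linarith)
  refine ⟨G ∘ₗ LinearMap.inl ℝ _ _, G ∘ₗ LinearMap.inr ℝ _ _, ?_, ?_, ?_⟩
  · intro v
    have := hG2 (v, 0)
    simpa [gg_zero] using this
  · intro v
    have := hG2 (0, v)
    simpa [gg_zero] using this
  · intro v
    have := hG1 ⟨(v, v), by
      change v - v = 0
      simp⟩
    have h2 : G (v, v) = 2 / w * α v := this
    rw [← h2]
    simp only [LinearMap.comp_apply, LinearMap.inl_apply, LinearMap.inr_apply, ← map_add]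
    simp

/-- the affine function `z ↦ 1 + L (z - p)`. -/
noncomputable def affAt (p : Euc n) (L : Euc n →ₗ[ℝ] ℝ) : Euc n →ᵃ[ℝ] ℝ :=
  L.toAffineMap + AffineMap.const ℝ (Euc n) (1 - L p)

lemma affAt_apply (p : Euc n) (L : Euc n →ₗ[ℝ] ℝ) (z : Euc n) :
    affAt p L z = 1 + L (z - p) := by
  simp [affAt]; ring

lemma aff_key (hD : GoodD D) {p q : Euc n} (hq : q ∈ D) (L : Euc n →ₗ[ℝ] ℝ)
    (hk : ∀ z ∈ D, 0 < affAt p L z) (v : Euc n) : - L v ≤ affAt p L q * gg D q v := by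
  refine le_of_forall_gt_imp_ge_of_dense ?_
  intro c hc
  have hkp := hk q hq
  set a := affAt p L q with ha
  have hc' : gg D q v < c / a := by rwa [lt_div_iff₀ hkp, mul_comm]
  have hcpos : 0 < c / a := lt_of_le_of_lt (gg_nonneg _) hc'
  rw [gg_lt_iff hD hq v hcpos] at hc'
  have := hk _ hc'
  have e : affAt p L (q + (c / a)⁻¹ • v) = a + (c / a)⁻¹ * L v := by
    rw [ha, affAt_apply, affAt_apply]
    have : q + (c / affAt p L q)⁻¹ • v - p = (q - p) + (c / affAt p L q)⁻¹ • v := by abel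
    rw [affAt_apply] at this
    rw [this, map_add, map_smul, smul_eq_mul]; ring
  rw [e] at this
  have hcp : 0 < c := by
    have := mul_pos hcpos hkp
    rwa [div_mul_cancel₀ _ hkp.ne'] at this
  rw [inv_div] at this
  have e2 : a * (c + L v) = (a + a / c * L v) * c := by field_simp
  have h6 : 0 < a * (c + L v) := by rw [e2]; positivity
  have := pos_of_mul_pos_right h6 hkp.le
  linarith

lemma pos1 (hD : GoodD D) {p : Euc n} (hp : p ∈ D) {A : Euc n →ₗ[ℝ] ℝ}
    (hA : ∀ v, A v ≤ gg D p v) : ∀ z ∈ D, 0 < affAt p (-A) z := by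
  intro z hz
  rw [affAt_apply, LinearMap.neg_apply]
  have := hA (z - p)
  have h3 : gg D p (z - p) < 1 := by rw [gg_lt_one hD hp]; simpa using hz
  linarith

lemma pos2 (hD : GoodD D) {p : Euc n} (hp : p ∈ D) {B : Euc n →ₗ[ℝ] ℝ}
    (hB : ∀ v, B v ≤ gg D p (-v)) : ∀ z ∈ D, 0 < affAt p B z := by
  intro z hz
  rw [affAt_apply]
  have := hB (-(z - p))
  rw [neg_neg, map_neg] at this
  have h3 : gg D p (z - p) < 1 := by rw [gg_lt_one hD hp]; simpa using hz
  linarith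

/-- the key consequence of hyperbolicity -/
lemma beta_lower (hD : GoodD D) {δ : ℝ} (hδ : 0 ≤ δ) (h : IsDeltaHyp D δ) {o e : Euc n}
    (ho : o ∈ closure D) {R x : ℝ} (hx : 0 < x) (hxR : x < R) (hp : o + x • e ∈ D)
    (hR : o + R • e ∉ D) {α : Euc n →ₗ[ℝ] ℝ} (hαe : α e = 0) {w : ℝ}
    (hw : IsW D (o + x • e) α w) {A B : Euc n →ₗ[ℝ] ℝ} (hA : ∀ v, A v ≤ gg D (o + x • e) v)
    (hB : ∀ v, B v ≤ gg D (o + x • e) (-v)) (hAB : ∀ v, A v + B v = (2 / w) * α v) :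
    ((Lam δ) ^ 2)⁻¹ ≤ (1 - x / R) * (1 + x * A e) := by
  have hR0 : 0 < R := hx.trans hxR
  set p := o + x • e with hpdef
  obtain ⟨hw0, ⟨u, hu1, hαu⟩, -⟩ := hw
  obtain ⟨f, hf⟩ := geometric_hahn_banach_open_point hD.cvx hD.opn hR
  have hfp := hf p hp
  have hfe : 0 < f e := by
    have e1 : f (o + R • e) - f p = (R - x) * f e := by
      rw [hpdef]; simp only [map_add, map_smul, smul_eq_mul]; ring
    have : 0 < (R - x) * f e := by rw [← e1]; linarith
    exact pos_of_mul_pos_right this (by linarith)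
  have hRx : 0 < R - x := by linarith
  set s := (R - x) * f e with hs
  have hs0 : 0 < s := by positivity
  let L3 : Euc n →ₗ[ℝ] ℝ := (-s⁻¹) • (f : Euc n →ₗ[ℝ] ℝ)
  have hL3 : ∀ v, L3 v = -s⁻¹ * f v := fun v => rfl
  have hf3 : ∀ z ∈ D, 0 < affAt p L3 z := by
    intro z hz
    rw [affAt_apply, hL3]
    have h1 := hf z hz
    have e1 : f (o + R • e) = f p + s := by
      rw [hpdef]; simp only [map_add, map_smul, smul_eq_mul]; rw [hs]; ring
    have e2 : 1 + -s⁻¹ * f (z - p) = s⁻¹ * (f (o + R • e) - f z) := by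
      rw [e1, map_sub]; field_simp; ring
    rw [e2]
    have : 0 < f (o + R • e) - f z := by linarith
    positivity
  have hcl : ∀ (k : Euc n →ᵃ[ℝ] ℝ), (∀ z ∈ D, 0 < k z) → ∀ z ∈ closure D, 0 ≤ k z := by
    intro k hk z hz
    have hcont : Continuous k := k.continuous_of_finiteDimensional
    have : closure D ⊆ {z | 0 ≤ k z} :=
      closure_minimal (fun z hz => (hk z hz).le) (isClosed_le continuous_const hcont)
    exact this hz
  have h1 := pos1 hD hp hA
  have h2 := pos2 hD hp hB
  have hop : o - p = -(x • e) := by rw [hpdef]; abel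
  have hBe : B e = - A e := by have := hAB e; rw [hαe] at this; linarith
  have o1 : affAt p (-A) o = 1 + x * A e := by
    rw [affAt_apply, hop]; simp
  have o2 : affAt p B o = 1 + x * A e := by
    rw [affAt_apply, hop]; simp [hBe]
  have o3 : (1 - x / R) * affAt p L3 o = 1 := by
    rw [affAt_apply, hop, hL3, map_neg, map_smul, smul_eq_mul, hs]
    field_simp; ring
  have hβ : 0 ≤ 1 + x * A e := by rw [← o1]; exact hcl _ h1 o ho
  have hk : 0 < 1 - x / R := by
    rw [sub_pos, div_lt_one hR0]; exact hxR
  have pp : ∀ L, affAt p L p = 1 := fun L => by rw [affAt_apply]; simp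
  have hgsum : gg D p u + gg D p (-u) = 2 := by
    rw [fNorm_eq hD hp] at hu1; linarith
  have hABu : A u + B u = 2 := by
    rw [hAB, hαu]; field_simp
  have hAu : A u = gg D p u := by have := hA u; have := hB u; linarith
  have hBu : B u = gg D p (-u) := by have := hA u; have := hB u; linarith
  have g0 := gg_nonneg (D := D) (p := p) u
  have g0' := gg_nonneg (D := D) (p := p) (-u)
  -- half points
  have hhalf : ∀ v, gg D p v ≤ 2 → p + (1/2 : ℝ) • v ∈ closure D := by
    intro v hv
    rw [← gg_le_one hD hp, gg_smul (by norm_num)]; linarith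
  have q1 := hcl _ hf3 _ (hhalf u (by linarith))
  have q2 := hcl _ hf3 _ (hhalf (-u) (by linarith))
  rw [affAt_apply, add_sub_cancel_left, map_smul, smul_eq_mul] at q1 q2
  rw [map_neg] at q2
  have hbcl : ∀ v, 0 < gg D p v → p + (gg D p v)⁻¹ • v ∈ closure D := by
    intro v hv
    rw [← gg_le_one hD hp, gg_smul (by positivity), inv_mul_cancel₀ hv.ne']
  rcases le_or_gt 1 (gg D p u) with hcase | hcase
  · have g1 : 0 < gg D p u := by linarith
    have gi : (gg D p u)⁻¹ ≤ 1 := inv_le_one_of_one_le₀ hcase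
    have gi0 : 0 < (gg D p u)⁻¹ := by positivity
    have hb := hbcl u g1
    refine corner_lemma hD hδ h hp ho hb h1 h2 hf3 (pp _) (pp _) (pp _) hk hβ o1 o2 o3
      ?_ ?_ ?_ (hcl _ hf3 _ hb) ?_
    · rw [affAt_apply, add_sub_cancel_left, map_smul, LinearMap.neg_apply, hAu]
      simp [g1.ne']
    · rw [affAt_apply, add_sub_cancel_left, map_smul, hBu, smul_eq_mul]
      have := mul_nonneg gi0.le g0'
      linarith
    · rw [affAt_apply, add_sub_cancel_left, map_smul, hBu, smul_eq_mul]
      nlinarith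
    · rw [affAt_apply, add_sub_cancel_left, map_smul, smul_eq_mul]
      nlinarith
  · have g1 : 0 < gg D p (-u) := by linarith
    have gi : (gg D p (-u))⁻¹ ≤ 1 := inv_le_one_of_one_le₀ (by linarith)
    have gi0 : 0 < (gg D p (-u))⁻¹ := by positivity
    have hb := hbcl (-u) g1
    refine corner_lemma hD hδ h hp ho hb h2 h1 hf3 (pp _) (pp _) (pp _) hk hβ o2 o1 o3
      ?_ ?_ ?_ (hcl _ hf3 _ hb) ?_
    · rw [affAt_apply, add_sub_cancel_left, map_smul, map_neg, hBu]
      simp [g1.ne']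
    · rw [affAt_apply, add_sub_cancel_left, map_smul, LinearMap.neg_apply, map_neg, hAu,
        smul_eq_mul]
      have := mul_nonneg gi0.le g0
      linarith
    · rw [affAt_apply, add_sub_cancel_left, map_smul, LinearMap.neg_apply, map_neg, hAu,
        smul_eq_mul]
      nlinarith
    · rw [affAt_apply, add_sub_cancel_left, map_smul, map_neg, smul_eq_mul]
      nlinarith

/-- one-step decay of the angular width -/
lemma width_decay (hD : GoodD D) {δ : ℝ} (hδ : 0 ≤ δ) (h : IsDeltaHyp D δ) {o e : Euc n}
    (ho : o ∈ closure D) {R x x' : ℝ} (hx : 0 < x) (hxx : x ≤ x') (hxR : x' < R)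
    (hp : o + x • e ∈ D) (hp' : o + x' • e ∈ D)
    (hR : o + R • e ∉ D) {α : Euc n →ₗ[ℝ] ℝ} (hαe : α e = 0) {w w' : ℝ}
    (hw : IsW D (o + x • e) α w) (hw' : IsW D (o + x' • e) α w') :
    w' / x' ≤ (w / x) * (1 - ((Lam δ) ^ 2)⁻¹ * (1 - (x * (R - x')) / (x' * (R - x)))) := by
  obtain ⟨A, B, hA, hB, hAB⟩ := isW_pair hD hp hw
  have hβ := beta_lower hD hδ h ho hx (hxx.trans_lt hxR) hp hR hαe hw hA hB hAB
  obtain ⟨hw0, -, -⟩ := hw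
  obtain ⟨hw0', ⟨u, hu1, hαu⟩, -⟩ := hw'
  have h1 := aff_key hD hp' (-A) (pos1 hD hp hA) u
  have h2 := aff_key hD hp' B (pos2 hD hp hB) (-u)
  have hBe : B e = - A e := by have := hAB e; rw [hαe] at this; linarith
  have hpp : o + x' • e - (o + x • e) = (x' - x) • e := by rw [sub_smul]; abel
  rw [affAt_apply, hpp] at h1 h2
  simp only [LinearMap.neg_apply, map_smul, map_neg, neg_neg, smul_eq_mul, hBe] at h1 h2
  rw [fNorm_eq hD hp'] at hu1
  have h3 := hAB u
  rw [hαu] at h3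
  set a := A e
  have h4 : (2 / w) * w' ≤ 2 * (1 - (x' - x) * a) := by
    rw [← h3]
    calc A u + B u ≤ (1 - (x' - x) * a) * (gg D (o + x' • e) u + gg D (o + x' • e) (-u)) := by
          linarith
      _ = _ := by
          have : gg D (o + x' • e) u + gg D (o + x' • e) (-u) = 2 := by linarith
          rw [this]; ring
  have h5 : w' ≤ w * (1 - (x' - x) * a) := by
    rw [div_mul_eq_mul_div, div_le_iff₀ hw0] at h4; linarith
  have hx' : 0 < x' := by linarith
  have hR0 : 0 < R := by linarith
  have hRx : 0 < R - x := by linarith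
  set c := ((Lam δ) ^ 2)⁻¹
  have h6 : c * (1 - (x * (R - x')) / (x' * (R - x))) ≤ (1 + x * a) * ((x' - x) / x') := by
    have e1 : 1 - (x * (R - x')) / (x' * (R - x)) = R * (x' - x) / (x' * (R - x)) := by
      field_simp; ring
    have e2 : (1 + x * a) * ((x' - x) / x') =
        ((1 - x / R) * (1 + x * a)) * (R * (x' - x) / (x' * (R - x))) := by
      field_simp
    rw [e1, e2]
    refine mul_le_mul_of_nonneg_right hβ ?_
    apply div_nonneg
    · exact mul_nonneg hR0.le (by linarith)
    · positivity
  have h7 : w' / x' ≤ (w / x) * (1 - (1 + x * a) * ((x' - x) / x')) := by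
    have : (w / x) * (1 - (1 + x * a) * ((x' - x) / x')) = w * (1 - (x' - x) * a) / x' := by
      field_simp; ring
    rw [this]; gcongr
  refine h7.trans ?_
  gcongr

end opt

lemma decay_iter {c : ℝ} (hc0 : 0 < c) (m : ℝ → ℝ) (hm : ∀ τ, 0 ≤ m τ)
    (h : ∀ τ τ', τ ≤ τ' → m τ' ≤ m τ * (1 - c * (1 - Real.exp (-(τ' - τ))))) :
    ∀ τ τ', τ ≤ τ' → m τ' ≤ m τ * Real.exp (-(c / 2) * (τ' - τ)) := by
  have short : ∀ τ τ', τ ≤ τ' → τ' - τ ≤ 1 → m τ' ≤ m τ * Real.exp (-(c / 2) * (τ' - τ)) := by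
    intro τ τ' h1 h2
    refine (h τ τ' h1).trans (mul_le_mul_of_nonneg_left ?_ (hm τ))
    set s := τ' - τ
    have hs : 0 ≤ s := by simp only [s]; linarith
    have e1 : Real.exp (-s) ≤ 1 - s / 2 := by
      rw [Real.exp_neg, inv_le_comm₀ (Real.exp_pos _) (by linarith)]
      refine le_trans ?_ (Real.add_one_le_exp s)
      rw [inv_le_iff_one_le_mul₀ (by linarith)]
      nlinarith
    have e2 := Real.add_one_le_exp (-(c / 2) * s)
    nlinarith
  have main : ∀ N : ℕ, ∀ τ τ' : ℝ, τ ≤ τ' → τ' - τ ≤ N → m τ' ≤ m τ * Real.exp (-(c / 2) * (τ' - τ)) := by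
    intro N
    induction N with
    | zero => intro τ τ' h1 h2; exact short τ τ' h1 (by push_cast at h2; linarith)
    | succ N ih =>
      intro τ τ' h1 h2
      push_cast at h2
      by_cases h3 : τ' - τ ≤ 1
      · exact short τ τ' h1 h3
      · push Not at h3
        have a1 := short τ (τ + 1) (by linarith) (by linarith)
        have a2 := ih (τ + 1) τ' (by linarith) (by linarith)
        refine a2.trans ((mul_le_mul_of_nonneg_right a1 (Real.exp_pos _).le).trans (le_of_eq ?_))
        rw [mul_assoc, ← Real.exp_add]
        congr 2; ring
  intro τ τ' h1
  obtain ⟨N, hN⟩ := exists_nat_ge (τ' - τ)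
  exact main N τ τ' h1 hN

lemma isW_unique {n : ℕ} {D : Set (Euc n)} {p : Euc n} {α : Euc n →ₗ[ℝ] ℝ} {w w' : ℝ}
    (h : IsW D p α w) (h' : IsW D p α w') : w = w' := by
  obtain ⟨u, hu, hu'⟩ := h.2.1
  obtain ⟨v, hv, hv'⟩ := h'.2.1
  have a1 := h'.2.2 u
  have a2 := h.2.2 v
  rw [hu] at a1; rw [hv] at a2
  linarith

lemma width_mult {n : ℕ} {D : Set (Euc n)} (hD : GoodD D) {δ : ℝ} (hδ : 0 ≤ δ)
    (h : IsDeltaHyp D δ) {o e : Euc n} (ho : o ∈ closure D) {R : ℝ}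
    (hray : ∀ x, 0 < x → x < R → o + x • e ∈ D) (hR : o + R • e ∉ D)
    {α : Euc n →ₗ[ℝ] ℝ} (hα : α ≠ 0) (hαe : α e = 0) {x x' w w' : ℝ}
    (hx : 0 < x) (hxx : x ≤ x') (hxR : x' < R)
    (hw : IsW D (o + x • e) α w) (hw' : IsW D (o + x' • e) α w') :
    w' / x' ≤ (w / x) * ((x / (R - x)) / (x' / (R - x'))) ^ ((((Lam δ) ^ 2)⁻¹) / 2) := by
  have hR0 : 0 < R := by linarith
  have hx'0 : 0 < x' := by linarith
  set c := ((Lam δ) ^ 2)⁻¹ with hc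
  have hc0 : 0 < c := by
    have := one_lt_Lam hδ
    positivity
  let X : ℝ → ℝ := fun τ => R * Real.exp τ / (1 + Real.exp τ)
  have X0 : ∀ τ, 0 < X τ := fun τ => by positivity
  have XR : ∀ τ, X τ < R := fun τ => by
    have := Real.exp_pos τ
    simp only [X]
    rw [div_lt_iff₀ (by positivity)]; nlinarith
  have XD : ∀ τ, o + X τ • e ∈ D := fun τ => hray _ (X0 τ) (XR τ)
  choose W hW using fun τ => exists_isW hD (XD τ) hα
  have Xmono : ∀ τ τ', τ ≤ τ' → X τ ≤ X τ' := by
    intro τ τ' ht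
    have := Real.exp_le_exp.2 ht
    have := Real.exp_pos τ
    simp only [X]
    rw [div_le_div_iff₀ (by positivity) (by positivity)]
    nlinarith [mul_le_mul_of_nonneg_left ‹Real.exp τ ≤ _› hR0.le]
  have key := decay_iter hc0 (fun τ => W τ / X τ) (fun τ => (div_pos (hW τ).1 (X0 τ)).le) (by
    intro τ τ' ht
    have := width_decay hD hδ h ho (X0 τ) (Xmono _ _ ht) (XR τ') (XD τ) (XD τ') hR hαe (hW τ) (hW τ')
    convert this using 5
    have := Real.exp_pos τ
    have := Real.exp_pos τ'
    have e1 : R - X τ = R / (1 + Real.exp τ) := by simp only [X]; field_simp; ring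
    have e2 : R - X τ' = R / (1 + Real.exp τ') := by simp only [X]; field_simp; ring
    rw [e1, e2]
    simp only [X]
    rw [neg_sub, Real.exp_sub]
    field_simp)
  have inv : ∀ z, 0 < z → z < R → X (Real.log (z / (R - z))) = z := by
    intro z h1 h2
    have : 0 < R - z := by linarith
    simp only [X]
    rw [Real.exp_log (by positivity)]
    field_simp
    ring
  have hxR' : x < R := by linarith
  have p1 : 0 < x / (R - x) := div_pos hx (by linarith)
  have p2 : 0 < x' / (R - x') := div_pos hx'0 (by linarith)
  have := key (Real.log (x / (R - x))) (Real.log (x' / (R - x'))) (by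
    apply Real.log_le_log p1
    rw [div_le_div_iff₀ (by linarith) (by linarith)]
    nlinarith)
  simp only [inv x hx hxR', inv x' hx'0 hxR] at this
  have a1 := hW (Real.log (x / (R - x)))
  rw [inv x hx hxR'] at a1
  have a2 := hW (Real.log (x' / (R - x')))
  rw [inv x' hx'0 hxR] at a2
  rw [isW_unique a1 hw, isW_unique a2 hw'] at this
  convert this using 2
  rw [Real.rpow_def_of_pos (div_pos p1 p2), Real.log_div p1.ne' p2.ne']
  congr 1; ring

lemma lint_euc2 {F : Euc 2 → ℝ≥0∞} (hF : Measurable F) :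
    ∫⁻ p, F p = ∫⁻ a : ℝ, ∫⁻ b : ℝ, F !₂[a, b] := by
  have m1 := (EuclideanSpace.volume_preserving_symm_measurableEquiv_toLp (Fin 2)).symm
  have m2 := (volume_preserving_finTwoArrow ℝ).symm
  have m3 := m1.comp m2
  rw [← m3.lintegral_comp hF]
  rw [Measure.volume_eq_prod]
  rw [lintegral_prod]
  · rfl
  · exact (hF.comp m3.measurable).aemeasurable

lemma meas_mk2 : Measurable (fun q : ℝ × ℝ => (!₂[q.1, q.2] : Euc 2)) := by
  have : Continuous (fun q : ℝ × ℝ => (!₂[q.1, q.2] : Euc 2)) := by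
    apply (PiLp.continuous_toLp 2 _).comp
    fun_prop
  exact this.measurable

lemma lint_shear {F : Euc 2 → ℝ≥0∞} (hF : Measurable F) (y : ℝ) :
    ∫⁻ p, F p = ∫⁻ h : ℝ, ∫⁻ a : ℝ, F !₂[a, y * a + h] := by
  have : Measurable (fun q : ℝ × ℝ => F !₂[q.2, y * q.2 + q.1]) :=
    hF.comp (meas_mk2.comp (by fun_prop : Measurable fun q : ℝ × ℝ => (q.2, y * q.2 + q.1)))
  rw [lint_euc2 hF]
  refine Eq.trans ?_ (lintegral_lintegral_swap (f := fun h a => F !₂[a, y * a + h])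
    this.aemeasurable).symm
  refine lintegral_congr fun a => ?_
  exact (lintegral_add_left_eq_self (μ := (volume : Measure ℝ)) (fun b => F !₂[a, b]) (y * a)).symm

lemma lint_polar {F : Euc 2 → ℝ≥0∞} (hF : Measurable F) (o : Euc 2)
    (h0 : ∀ p, p 0 ≤ o 0 → F p = 0) :
    ∫⁻ p, F p = ∫⁻ y : ℝ, ∫⁻ x in Ioi (0:ℝ), ENNReal.ofReal x * F (o + x • !₂[1, y]) := by
  have hG : Measurable (fun q : ℝ × ℝ => F (o + !₂[q.1, q.2])) :=
    hF.comp ((measurable_const.add meas_mk2))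
  have hG2 : Measurable (fun q : ℝ × ℝ => ENNReal.ofReal q.1 * F (o + q.1 • !₂[1, q.2])) := by
    refine Measurable.mul (by fun_prop) (hF.comp (measurable_const.add (Measurable.smul measurable_fst ?_)))
    exact meas_mk2.comp (by fun_prop : Measurable fun q : ℝ × ℝ => ((1:ℝ), q.2))
  have t1 : ∫⁻ p, F p = ∫⁻ p, F (o + p) := (lintegral_add_left_eq_self F o).symm
  rw [t1, lint_euc2 (F := fun p => F (o + p)) (hF.comp (measurable_const_add o))]
  have e1 : ∀ a : ℝ, ∫⁻ b : ℝ, F (o + !₂[a, b]) =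
      (Ioi (0:ℝ)).indicator (fun x => ∫⁻ y : ℝ, ENNReal.ofReal x * F (o + x • !₂[1, y])) a := by
    intro a
    by_cases ha : 0 < a
    · rw [indicator_of_mem (mem_Ioi.2 ha)]
      have hm : Measurable (fun b : ℝ => F (o + !₂[a, b])) := hG.comp (measurable_prodMk_left)
      have e2 : ∀ y : ℝ, a • (!₂[1, y] : Euc 2) = !₂[a, a * y] := by
        intro y; ext i; fin_cases i <;> simp
      simp_rw [e2]
      have hm2 : Measurable (fun y : ℝ => F (o + !₂[a, a * y])) := hm.comp (measurable_const_mul a)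
      have := Real.smul_map_volume_mul_left ha.ne'
      rw [abs_of_pos ha] at this
      rw [lintegral_const_mul _ hm2]
      conv_lhs => rw [← this]
      rw [lintegral_smul_measure, lintegral_map hm (measurable_const_mul a), smul_eq_mul]
    · rw [indicator_of_notMem (by simpa using ha)]
      have : ∀ b : ℝ, F (o + !₂[a, b]) = 0 := fun b => h0 _ (by simp; linarith)
      simp [this]
  simp_rw [e1]
  rw [lintegral_indicator measurableSet_Ioi, lintegral_lintegral_swap hG2.aemeasurable]

noncomputable def alph (y : ℝ) : Euc 2 →ₗ[ℝ] ℝ where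
  toFun u := u 1 - y * u 0
  map_add' u v := by simp; ring
  map_smul' s u := by simp; ring

lemma alph_apply (y : ℝ) (u : Euc 2) : alph y u = u 1 - y * u 0 := rfl

lemma alph_ne (y : ℝ) : alph y ≠ 0 := by
  intro h
  have := congrArg (fun l => l (!₂[0, 1] : Euc 2)) h
  simp [alph_apply] at this

lemma alph_e (y : ℝ) : alph y !₂[1, y] = 0 := by simp [alph_apply]

lemma e_ne (y : ℝ) : (!₂[1, y] : Euc 2) ≠ 0 := by
  intro h
  have := congrArg (fun l : Euc 2 => l 0) h
  simp at this

lemma tb_open {n : ℕ} {D : Set (Euc n)} (hD : GoodD D) {p : Euc n} (hp : p ∈ D) (r : ℝ) :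
    IsOpen (tangentBall D p r) := isOpen_lt (fN_cont hD hp) continuous_const

lemma fN_smul_abs {n : ℕ} {D : Set (Euc n)} (hD : GoodD D) {p : Euc n} (hp : p ∈ D) (s : ℝ)
    (u : Euc n) : fNorm D p (s • u) = |s| * fNorm D p u := by
  rcases le_total 0 s with h | h
  · rw [abs_of_nonneg h, fN_smul hD hp h]
  · rw [abs_of_nonpos h, ← fN_smul hD hp (by linarith), neg_smul, fN_neg hD hp]

lemma area_slice {D : Set (Euc 2)} (hD : GoodD D) {p : Euc 2} (hp : p ∈ D) (y : ℝ) :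
    volume (tangentBall D p 1) =
      ∫⁻ h : ℝ, volume {a : ℝ | (!₂[a, y * a + h] : Euc 2) ∈ tangentBall D p 1} := by
  have hm := (tb_open hD hp 1).measurableSet
  rw [← lintegral_indicator_one hm, lint_shear (measurable_one.indicator hm) y]
  refine lintegral_congr fun h => ?_
  have hm2 : MeasurableSet {a : ℝ | (!₂[a, y * a + h] : Euc 2) ∈ tangentBall D p 1} :=
    (meas_mk2.comp (by fun_prop : Measurable fun a : ℝ => (a, y * a + h))) hm
  rw [← lintegral_indicator_one hm2]
  rfl

lemma area_upper {D : Set (Euc 2)} (hD : GoodD D) {p : Euc 2} (hp : p ∈ D) {y w : ℝ}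
    (hw : IsW D p (alph y) w) :
    volume (tangentBall D p 1) ≤ ENNReal.ofReal (4 * ((fNorm D p !₂[1, y])⁻¹ * w)) := by
  have hN := fN_pos hD hp (e_ne y)
  have hw0 := hw.1
  rw [area_slice hD hp y]
  calc _ ≤ ∫⁻ h : ℝ, (Ioo (-w) w).indicator
        (fun _ => ENNReal.ofReal (2 * (fNorm D p !₂[1, y])⁻¹)) h := by
        refine lintegral_mono fun h => ?_
        by_cases hh : h ∈ Ioo (-w) w
        · rw [indicator_of_mem hh]
          refine (Real.volume_le_diam _).trans (Metric.ediam_le fun a ha b hb => ?_)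
          rw [edist_dist, Real.dist_eq]
          apply ENNReal.ofReal_le_ofReal
          have h1 : fNorm D p ((a - b) • !₂[1, y]) ≤ 2 := by
            have : ((a - b) • !₂[1, y] : Euc 2) = !₂[a, y * a + h] + -!₂[b, y * b + h] := by
              ext i; fin_cases i <;> simp <;> ring
            rw [this]
            refine (fN_add hD hp _ _).trans ?_
            rw [fN_neg hD hp]
            have a1 : fNorm D p !₂[a, y * a + h] < 1 := ha
            have a2 : fNorm D p !₂[b, y * b + h] < 1 := hb
            linarith
          rw [fN_smul_abs hD hp] at h1
          rw [← div_eq_mul_inv, le_div_iff₀ hN]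
          exact h1
        · rw [indicator_of_notMem hh]
          have : {a : ℝ | (!₂[a, y * a + h] : Euc 2) ∈ tangentBall D p 1} = ∅ := by
            ext a
            simp only [mem_ofPred_eq, mem_empty_iff_false, iff_false]
            intro (ha : fNorm D p _ < 1)
            apply hh
            have h1 := hw.2.2 !₂[a, y * a + h]
            have h2 := hw.2.2 (-!₂[a, y * a + h])
            rw [fN_neg hD hp, map_neg] at h2
            have h3 : alph y !₂[a, y * a + h] = h := by simp [alph_apply]
            rw [h3] at h1 h2
            constructor <;> nlinarith
          rw [this]; simp
    _ = _ := by
        rw [lintegral_indicator measurableSet_Ioo, setLIntegral_const, Real.volume_Ioo,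
          ← ENNReal.ofReal_mul (by positivity)]
        congr 1; ring

lemma area_lower {D : Set (Euc 2)} (hD : GoodD D) {p : Euc 2} (hp : p ∈ D) {y w : ℝ}
    (hw : IsW D p (alph y) w) :
    ENNReal.ofReal ((fNorm D p !₂[1, y])⁻¹ * w) ≤ volume (tangentBall D p 1) := by
  have hN := fN_pos hD hp (e_ne y)
  have hw0 := hw.1
  obtain ⟨u, hu, huw⟩ := hw.2.1
  set N := fNorm D p !₂[1, y] with hNd
  rw [area_slice hD hp y]
  calc _ = ∫⁻ h : ℝ, (Ioo (-(w/2)) (w/2)).indicator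
        (fun _ => ENNReal.ofReal (N⁻¹)) h := by
        rw [lintegral_indicator measurableSet_Ioo, setLIntegral_const, Real.volume_Ioo,
          ← ENNReal.ofReal_mul (by positivity)]
        congr 1; ring
    _ ≤ _ := by
        refine lintegral_mono fun h => ?_
        by_cases hh : h ∈ Ioo (-(w/2)) (w/2)
        · rw [indicator_of_mem hh]
          have : ENNReal.ofReal N⁻¹ = volume (Ioo (h / w * u 0 - N⁻¹ / 2) (h / w * u 0 + N⁻¹ / 2)) := by
            rw [Real.volume_Ioo]; congr 1; ring
          rw [this]
          apply measure_mono
          intro a ha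
          have e1 : (!₂[a, y * a + h] : Euc 2) = (h / w) • u + (a - h / w * u 0) • !₂[1, y] := by
            rw [alph_apply] at huw
            have : u 1 = w + y * u 0 := by linarith
            ext i; fin_cases i
            · simp
            · simp [this]; field_simp; ring
          change fNorm D p _ < 1
          rw [e1]
          refine (fN_add hD hp _ _).trans_lt ?_
          rw [fN_smul_abs hD hp, fN_smul_abs hD hp, hu, ← hNd]
          have b1 : |h / w| < 1 / 2 := by
            rw [abs_div, abs_of_pos hw0, div_lt_iff₀ hw0, abs_lt]
            constructor <;> linarith [hh.1, hh.2]
          have b2 : |a - h / w * u 0| < N⁻¹ / 2 := by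
            rw [abs_lt]; constructor <;> linarith [ha.1, ha.2]
          have b3 : |a - h / w * u 0| * N < N⁻¹ / 2 * N := by gcongr
          have b4 : N⁻¹ / 2 * N = 1 / 2 := by field_simp
          linarith
        · rw [indicator_of_notMem hh]; exact zero_le

lemma cs_sq {α : Type*} [MeasurableSpace α] (μ : Measure α) {f g : α → ℝ≥0∞}
    (hf : AEMeasurable f μ) (hg : AEMeasurable g μ) :
    (∫⁻ a, f a * g a ∂μ) ^ 2 ≤ (∫⁻ a, f a ^ 2 ∂μ) * (∫⁻ a, g a ^ 2 ∂μ) := by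
  have h := ENNReal.lintegral_mul_le_Lp_mul_Lq μ Real.HolderConjugate.two_two hf hg
  have h2 := pow_le_pow_left' h 2
  refine h2.trans (le_of_eq ?_)
  rw [mul_pow, ← ENNReal.rpow_natCast, ← ENNReal.rpow_natCast, ← ENNReal.rpow_mul, ← ENNReal.rpow_mul]
  norm_num

noncomputable def VV (R x : ℝ) : ℝ := x / (R - x)
noncomputable def psi (R x : ℝ) : ℝ := R / (2 * x * (R - x))

lemma VV_pos {R x : ℝ} (h : x ∈ Ioo 0 R) : 0 < VV R x := div_pos h.1 (by linarith [h.2])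
lemma psi_pos {R x : ℝ} (h : x ∈ Ioo 0 R) : 0 < psi R x :=
  div_pos (h.1.trans h.2) (mul_pos (by linarith [h.1]) (by linarith [h.2]))

lemma VV_mono {R x x' : ℝ} (h : x ∈ Ioo 0 R) (h' : x' ∈ Ioo 0 R) (hx : x ≤ x') : VV R x ≤ VV R x' := by
  unfold VV
  rw [div_le_div_iff₀ (by linarith [h.2]) (by linarith [h'.2])]
  nlinarith [h.1, h.2]

lemma VV_deriv {R x : ℝ} (h : x ∈ Ioo 0 R) : HasDerivAt (VV R) (VV R x * (2 * psi R x)) x := by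
  have h1 : R - x ≠ 0 := by linarith [h.2]
  have h2 : x ≠ 0 := h.1.ne'
  have := (hasDerivAt_id x).div ((hasDerivAt_const x R).sub (hasDerivAt_id x)) h1
  refine this.congr_deriv ?_
  simp only [VV, psi, id]
  simp only [Pi.sub_apply, id]
  field_simp
  ring

lemma Vpow_deriv {R x b : ℝ} (h : x ∈ Ioo 0 R) (hb : b ≠ 0) :
    HasDerivAt (fun x => VV R x ^ b / (2 * b)) (VV R x ^ b * psi R x) x := by
  have := ((VV_deriv h).rpow_const (p := b) (Or.inl (VV_pos h).ne')).div_const (2 * b)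
  refine this.congr_deriv ?_
  have hv := VV_pos h
  rw [Real.rpow_sub_one hv.ne']
  field_simp

lemma int1 {R a x : ℝ} (ha : 0 < a) (hx : x ∈ Ioo 0 R) :
    ∫⁻ ξ in Ioo x R, ENNReal.ofReal (VV R ξ ^ (-a) * psi R ξ) ≤
      ENNReal.ofReal (VV R x ^ (-a) / (2 * a)) := by
  have sub : ∀ ξ ∈ Ioo x R, ξ ∈ Ioo 0 R := fun ξ h => ⟨hx.1.trans h.1, h.2⟩
  have mono : ∀ ξ ∈ Ioo 0 R, ∀ ξ' ∈ Ioo 0 R, ξ ≤ ξ' → VV R ξ' ^ (-a) ≤ VV R ξ ^ (-a) := by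
    intro ξ h ξ' h' hh
    exact Real.rpow_le_rpow_of_nonpos (VV_pos h) (VV_mono h h' hh) (by linarith)
  rw [lintegral_deriv_eq_volume_image_of_monotoneOn (f := fun x => VV R x ^ (-a) / (2 * (-a)))
    measurableSet_Ioo]
  · have : VV R x ^ (-a) / (2 * a) = 0 - (VV R x ^ (-a) / (2 * (-a))) := by
      rw [mul_neg, div_neg]; ring
    rw [this, ← Real.volume_Icc]
    apply measure_mono
    rintro _ ⟨ξ, hξ, rfl⟩
    have h1 := mono x hx ξ (sub ξ hξ) hξ.1.le
    have h2 := Real.rpow_pos_of_pos (VV_pos (sub ξ hξ)) (-a)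
    constructor
    · simp only
      rw [mul_neg, div_neg, div_neg, neg_le_neg_iff]
      gcongr
    · simp only
      rw [mul_neg, div_neg]
      have : 0 < VV R ξ ^ (-a) / (2 * a) := by positivity
      linarith
  · intro ξ hξ
    exact (Vpow_deriv (sub ξ hξ) (by linarith)).hasDerivWithinAt
  · intro ξ hξ ξ' hξ' hh
    simp only
    rw [mul_neg, div_neg, div_neg, neg_le_neg_iff]
    have := mono ξ (sub ξ hξ) ξ' (sub ξ' hξ') hh
    gcongr

lemma int2 {R a x : ℝ} (ha : 0 < a) (hx : x ∈ Ioo 0 R) :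
    ∫⁻ ξ in Ioo 0 x, ENNReal.ofReal (VV R ξ ^ a * psi R ξ) ≤
      ENNReal.ofReal (VV R x ^ a / (2 * a)) := by
  have sub : ∀ ξ ∈ Ioo 0 x, ξ ∈ Ioo 0 R := fun ξ h => ⟨h.1, h.2.trans hx.2⟩
  have mono : ∀ ξ ∈ Ioo 0 R, ∀ ξ' ∈ Ioo 0 R, ξ ≤ ξ' → VV R ξ ^ a ≤ VV R ξ' ^ a := by
    intro ξ h ξ' h' hh
    exact Real.rpow_le_rpow (VV_pos h).le (VV_mono h h' hh) ha.le
  rw [lintegral_deriv_eq_volume_image_of_monotoneOn (f := fun x => VV R x ^ a / (2 * a))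
    measurableSet_Ioo]
  · have : VV R x ^ a / (2 * a) = VV R x ^ a / (2 * a) - 0 := by ring
    rw [this, ← Real.volume_Icc]
    apply measure_mono
    rintro _ ⟨ξ, hξ, rfl⟩
    have h1 := mono ξ (sub ξ hξ) x hx hξ.2.le
    have h2 := Real.rpow_pos_of_pos (VV_pos (sub ξ hξ)) a
    constructor
    · positivity
    · simp only; gcongr
  · intro ξ hξ
    exact (Vpow_deriv (sub ξ hξ) ha.ne').hasDerivWithinAt
  · intro ξ hξ ξ' hξ' hh
    have := mono ξ (sub ξ hξ) ξ' (sub ξ' hξ') hh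
    simp only
    gcongr

lemma VV_meas (R : ℝ) : Measurable (VV R) := by unfold VV; fun_prop
lemma psi_meas (R : ℝ) : Measurable (psi R) := by unfold psi; fun_prop

lemma g_bound {R a x : ℝ} (ha : 0 < a) (hx : x ∈ Ioo 0 R) {g : ℝ → ℝ} {K : ℝ≥0}
    (hg : LipschitzWith K g) (hgR : g R = 0) :
    ENNReal.ofReal (g x ^ 2) ≤ ENNReal.ofReal (VV R x ^ (-a) / (2 * a)) *
      ∫⁻ ξ in Ioo x R, ENNReal.ofReal (deriv g ξ ^ 2 * VV R ξ ^ a / psi R ξ) := by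
  have sub : ∀ ξ ∈ Ioo x R, ξ ∈ Ioo 0 R := fun ξ h => ⟨hx.1.trans h.1, h.2⟩
  have hV := VV_meas R
  have hψ := psi_meas R
  have hd := measurable_deriv g
  have h1 : ENNReal.ofReal |g x| ≤ ∫⁻ ξ in Ioo x R, ENNReal.ofReal |deriv g ξ| := by
    have h2 := (hg.lipschitzOnWith (s := uIcc x R)).absolutelyContinuousOnInterval.integral_deriv_eq_sub
    rw [hgR, intervalIntegral.integral_of_le hx.2.le, integral_Ioc_eq_integral_Ioo] at h2
    have h3 : |g x| = ‖∫ (t : ℝ) in Ioo x R, deriv g t‖ := by rw [h2]; simp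
    rw [h3, ofReal_norm]
    refine (enorm_integral_le_lintegral_enorm _).trans (le_of_eq ?_)
    refine lintegral_congr fun ξ => ?_
    rw [Real.enorm_eq_ofReal_abs]
  have h4 : ENNReal.ofReal (g x ^ 2) = ENNReal.ofReal |g x| ^ 2 := by
    rw [← ENNReal.ofReal_pow (abs_nonneg _), sq_abs]
  rw [h4]
  calc _ ≤ (∫⁻ ξ in Ioo x R, ENNReal.ofReal |deriv g ξ|) ^ 2 := pow_le_pow_left' h1 2
    _ = (∫⁻ ξ in Ioo x R, ENNReal.ofReal (Real.sqrt (VV R ξ ^ (-a) * psi R ξ)) *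
        ENNReal.ofReal (|deriv g ξ| / Real.sqrt (VV R ξ ^ (-a) * psi R ξ))) ^ 2 := by
      congr 1
      refine setLIntegral_congr_fun measurableSet_Ioo fun ξ hξ => ?_
      have := Real.rpow_pos_of_pos (VV_pos (sub ξ hξ)) (-a)
      have := psi_pos (sub ξ hξ)
      rw [← ENNReal.ofReal_mul (Real.sqrt_nonneg _), mul_div_cancel₀]
      positivity
    _ ≤ _ := cs_sq _ (by fun_prop) (by fun_prop)
    _ = (∫⁻ ξ in Ioo x R, ENNReal.ofReal (VV R ξ ^ (-a) * psi R ξ)) *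
        ∫⁻ ξ in Ioo x R, ENNReal.ofReal (deriv g ξ ^ 2 * VV R ξ ^ a / psi R ξ) := by
      congr 1
      · refine setLIntegral_congr_fun measurableSet_Ioo fun ξ hξ => ?_
        have := Real.rpow_pos_of_pos (VV_pos (sub ξ hξ)) (-a)
        have := psi_pos (sub ξ hξ)
        rw [← ENNReal.ofReal_pow (Real.sqrt_nonneg _), Real.sq_sqrt (by positivity)]
      · refine setLIntegral_congr_fun measurableSet_Ioo fun ξ hξ => ?_
        have := Real.rpow_pos_of_pos (VV_pos (sub ξ hξ)) (a)
        have := psi_pos (sub ξ hξ)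
        rw [← ENNReal.ofReal_pow (by positivity), div_pow, Real.rpow_neg (VV_pos (sub ξ hξ)).le,
          Real.sq_sqrt (by positivity), sq_abs]
        congr 1
        field_simp
    _ ≤ _ := by
      gcongr
      exact int1 ha hx

lemma hardy {R a : ℝ} (ha : 0 < a) {g : ℝ → ℝ} {K : ℝ≥0}
    (hg : LipschitzWith K g) (hgR : g R = 0) {H : ℝ → ℝ≥0∞} (hHm : Measurable H)
    (hH : ∀ x ∈ Ioo 0 R, ∀ x' ∈ Ioo 0 R, x ≤ x' →
      H x ≤ ENNReal.ofReal (4 * (VV R x / VV R x') ^ (2 * a)) * H x') :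
    ∫⁻ x in Ioo 0 R, ENNReal.ofReal (g x ^ 2 * psi R x) * H x ≤
      ENNReal.ofReal ((a ^ 2)⁻¹) *
        ∫⁻ x in Ioo 0 R, ENNReal.ofReal (deriv g x ^ 2 / psi R x) * H x := by
  have hV := VV_meas R
  have hψ := psi_meas R
  have hd := measurable_deriv g
  set A : ℝ → ℝ≥0∞ := fun x => ENNReal.ofReal (VV R x ^ a * psi R x) with hA
  set B : ℝ → ℝ≥0∞ := fun ξ =>
    ENNReal.ofReal (2 / a * (VV R ξ ^ (-a) * (deriv g ξ ^ 2 / psi R ξ))) * H ξ with hB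
  have hAm : Measurable A := by fun_prop
  have hBm : Measurable B := by fun_prop
  set T : Set (ℝ × ℝ) := {q | 0 < q.1 ∧ q.1 < q.2 ∧ q.2 < R} with hT
  have hTm : MeasurableSet T := by
    apply (measurableSet_lt measurable_const measurable_fst).inter
    apply (measurableSet_lt measurable_fst measurable_snd).inter
    exact (measurableSet_lt measurable_snd measurable_const)
  have step : ∀ x ∈ Ioo 0 R, ENNReal.ofReal (g x ^ 2 * psi R x) * H x ≤
      ∫⁻ ξ in Ioo x R, A x * B ξ := by
    intro x hx
    have hψx := psi_pos hx
    have hVx := VV_pos hx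
    calc _ = ENNReal.ofReal (g x ^ 2) * (ENNReal.ofReal (psi R x) * H x) := by
          rw [ENNReal.ofReal_mul (by positivity), mul_assoc]
      _ ≤ (ENNReal.ofReal (VV R x ^ (-a) / (2 * a)) *
          ∫⁻ ξ in Ioo x R, ENNReal.ofReal (deriv g ξ ^ 2 * VV R ξ ^ a / psi R ξ)) *
          (ENNReal.ofReal (psi R x) * H x) := by gcongr; exact g_bound ha hx hg hgR
      _ = (ENNReal.ofReal (VV R x ^ (-a) / (2 * a)) * (ENNReal.ofReal (psi R x) * H x)) *
          ∫⁻ ξ in Ioo x R, ENNReal.ofReal (deriv g ξ ^ 2 * VV R ξ ^ a / psi R ξ) := by ring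
      _ ≤ _ := lintegral_const_mul_le _ _
      _ ≤ _ := by
          refine setLIntegral_mono' measurableSet_Ioo fun ξ hξ => ?_
          have hξ' : ξ ∈ Ioo 0 R := ⟨hx.1.trans hξ.1, hξ.2⟩
          have hψξ := psi_pos hξ'
          have hVξ := VV_pos hξ'
          have p1 := Real.rpow_pos_of_pos hVx a
          have p2 := Real.rpow_pos_of_pos hVξ a
          calc _ ≤ (ENNReal.ofReal (VV R x ^ (-a) / (2 * a)) * (ENNReal.ofReal (psi R x) *
                (ENNReal.ofReal (4 * (VV R x / VV R ξ) ^ (2 * a)) * H ξ))) *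
                ENNReal.ofReal (deriv g ξ ^ 2 * VV R ξ ^ a / psi R ξ) := by
                gcongr; exact hH x hx ξ hξ' hξ.1.le
            _ = (ENNReal.ofReal (VV R x ^ (-a) / (2 * a)) * (ENNReal.ofReal (psi R x) *
                (ENNReal.ofReal (4 * (VV R x / VV R ξ) ^ (2 * a)) * 
                ENNReal.ofReal (deriv g ξ ^ 2 * VV R ξ ^ a / psi R ξ)))) * H ξ := by ring
            _ = A x * B ξ := by
                simp only [hA, hB]
                rw [← mul_assoc (ENNReal.ofReal (VV R x ^ a * psi R x))]
                congr 1
                rw [← ENNReal.ofReal_mul (by positivity), ← ENNReal.ofReal_mul (by positivity),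
                  ← ENNReal.ofReal_mul (by positivity), ← ENNReal.ofReal_mul (by positivity)]
                congr 1
                rw [Real.div_rpow hVx.le hVξ.le, two_mul a, Real.rpow_add hVx, Real.rpow_add hVξ,
                  Real.rpow_neg hVx.le, Real.rpow_neg hVξ.le]
                field_simp
                ring
  calc _ ≤ ∫⁻ x in Ioo 0 R, ∫⁻ ξ in Ioo x R, A x * B ξ := setLIntegral_mono' measurableSet_Ioo step
    _ = ∫⁻ x, ∫⁻ ξ, T.indicator (fun q => A q.1 * B q.2) (x, ξ) := by
        rw [← lintegral_indicator measurableSet_Ioo]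
        refine lintegral_congr fun x => ?_
        by_cases hx : x ∈ Ioo 0 R
        · rw [indicator_of_mem hx, ← lintegral_indicator measurableSet_Ioo]
          refine lintegral_congr fun ξ => ?_
          simp only [indicator, hT, mem_Ioo, mem_ofPred_eq]
          have := hx.1
          simp [this]
        · rw [indicator_of_notMem hx]
          have : ∀ ξ, T.indicator (fun q => A q.1 * B q.2) (x, ξ) = 0 := by
            intro ξ
            apply indicator_of_notMem
            intro h
            exact hx ⟨h.1, h.2.1.trans h.2.2⟩
          simp [this]
    _ = ∫⁻ ξ, ∫⁻ x, T.indicator (fun q => A q.1 * B q.2) (x, ξ) := by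
        refine lintegral_lintegral_swap (f := fun x ξ => T.indicator (fun q => A q.1 * B q.2) (x, ξ)) ?_
        refine Measurable.aemeasurable ?_
        exact Measurable.indicator (by fun_prop) hTm
    _ = ∫⁻ ξ in Ioo 0 R, ∫⁻ x in Ioo 0 ξ, A x * B ξ := by
        rw [← lintegral_indicator measurableSet_Ioo]
        refine lintegral_congr fun ξ => ?_
        by_cases hx : ξ ∈ Ioo 0 R
        · rw [indicator_of_mem hx, ← lintegral_indicator measurableSet_Ioo]
          refine lintegral_congr fun x => ?_
          simp only [indicator, hT, mem_Ioo, mem_ofPred_eq]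
          have := hx.2
          simp [this]
        · rw [indicator_of_notMem hx]
          have : ∀ x, T.indicator (fun q => A q.1 * B q.2) (x, ξ) = 0 := by
            intro x
            apply indicator_of_notMem
            intro h
            exact hx ⟨h.1.trans h.2.1, h.2.2⟩
          simp [this]
    _ ≤ ∫⁻ ξ in Ioo 0 R, ENNReal.ofReal ((a ^ 2)⁻¹) *
          (ENNReal.ofReal (deriv g ξ ^ 2 / psi R ξ) * H ξ) := by
        refine setLIntegral_mono' measurableSet_Ioo fun ξ hξ => ?_
        have hψξ := psi_pos hξ
        have hVξ := VV_pos hξ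
        have p2 := Real.rpow_pos_of_pos hVξ a
        rw [lintegral_mul_const _ hAm]
        calc _ ≤ ENNReal.ofReal (VV R ξ ^ a / (2 * a)) * B ξ := by gcongr; exact int2 ha hξ
          _ = _ := by
            simp only [hB]
            rw [← mul_assoc (ENNReal.ofReal (VV R ξ ^ a / (2 * a))),
              ← mul_assoc (ENNReal.ofReal (a ^ 2)⁻¹), ← ENNReal.ofReal_mul (by positivity),
              ← ENNReal.ofReal_mul (by positivity)]
            congr 2
            rw [Real.rpow_neg hVξ.le]
            field_simp
    _ = _ := by rw [lintegral_const_mul]; fun_prop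

section
variable {n : ℕ} {D : Set (Euc n)}

open Classical in
noncomputable def Gm (D : Set (Euc n)) (q : Euc n × Euc n) : ℝ := if q.1 ∈ D then gg D q.1 q.2 else 0

lemma Gm_meas (hD : GoodD D) : Measurable (Gm D) := by
  refine measurable_of_Iio fun c => ?_
  have hDm : MeasurableSet {q : Euc n × Euc n | q.1 ∈ D} := measurable_fst hD.opn.measurableSet
  by_cases hc : 0 < c
  · have : Gm D ⁻¹' Iio c = {q : Euc n × Euc n | q.1 ∈ D}ᶜ ∪
        ({q : Euc n × Euc n | q.1 ∈ D} ∩ {q : Euc n × Euc n | q.1 + c⁻¹ • q.2 ∈ D}) := by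
      ext q
      simp only [Gm, mem_preimage, mem_Iio, mem_union, mem_compl_iff, mem_inter_iff, mem_ofPred_eq]
      by_cases hq : q.1 ∈ D
      · simp [hq, gg_lt_iff hD hq _ hc]
      · simp [hq, hc]
    rw [this]
    refine hDm.compl.union (hDm.inter ?_)
    exact (by fun_prop : Measurable fun q : Euc n × Euc n => q.1 + c⁻¹ • q.2) hD.opn.measurableSet
  · have : Gm D ⁻¹' Iio c = ∅ := by
      ext q
      simp only [Gm, mem_preimage, mem_Iio, mem_empty_iff_false, iff_false, not_lt]
      split_ifs
      · exact (not_lt.1 hc).trans (gg_nonneg _)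
      · exact not_lt.1 hc
    rw [this]; exact MeasurableSet.empty

noncomputable def Fm (D : Set (Euc n)) (q : Euc n × Euc n) : ℝ :=
  (1 / 2) * (Gm D q + Gm D (q.1, -q.2))

lemma Fm_meas (hD : GoodD D) : Measurable (Fm D) := by
  have := Gm_meas hD
  unfold Fm
  fun_prop

lemma Fm_eq (hD : GoodD D) {p : Euc n} (hp : p ∈ D) (u : Euc n) : Fm D (p, u) = fNorm D p u := by
  rw [fNorm_eq hD hp]; simp [Fm, Gm, hp]

noncomputable def Am (D : Set (Euc n)) (p : Euc n) : ℝ≥0∞ := volume {u | Fm D (p, u) < 1}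

lemma Am_meas (hD : GoodD D) : Measurable (Am D) := by
  have : MeasurableSet {q | Fm D q < 1} := measurableSet_lt (Fm_meas hD) measurable_const
  exact measurable_measure_prodMk_left this

lemma Am_eq (hD : GoodD D) {p : Euc n} (hp : p ∈ D) : Am D p = volume (tangentBall D p 1) := by
  simp only [Am, Fm_eq hD hp, tangentBall]

lemma Am_pos (hD : GoodD D) {p : Euc n} (hp : p ∈ D) : 0 < Am D p := by
  rw [Am_eq hD hp]
  refine (tb_open hD hp 1).measure_pos _ ⟨0, ?_⟩
  change fNorm D p 0 < 1
  rw [fN_zero]; norm_num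

lemma Am_lt_top (hD : GoodD D) {p : Euc n} (hp : p ∈ D) : Am D p < ⊤ := by
  rw [Am_eq hD hp]
  obtain ⟨M, hM, h⟩ := fN_bound hD
  refine Bornology.IsBounded.measure_lt_top ((Metric.isBounded_ball (x := (0 : Euc n)) (r := M)).subset ?_)
  intro u (hu : fNorm D p u < 1)
  rw [mem_ball_zero_iff]
  have := h p hp u
  nlinarith

lemma dual_bdd (hD : GoodD D) {p : Euc n} (hp : p ∈ D) (l : Euc n →L[ℝ] ℝ) :
    BddAbove ((fun u => l u) '' {u : Euc n | fNorm D p u = 1}) := by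
  obtain ⟨M, hM, h⟩ := fN_bound hD
  refine ⟨‖l‖ * M, ?_⟩
  rintro _ ⟨u, hu : fNorm D p u = 1, rfl⟩
  have h1 := h p hp u
  rw [hu, mul_one] at h1
  exact ((le_abs_self _).trans (l.le_opNorm u)).trans (by gcongr)

lemma dual_nonneg (hD : GoodD D) {p : Euc n} (hp : p ∈ D) (l : Euc n →L[ℝ] ℝ) :
    0 ≤ dualNorm D p l := by
  unfold dualNorm
  rcases (Set.eq_empty_or_nonempty {u : Euc n | fNorm D p u = 1}) with h | ⟨u, hu⟩
  · rw [h]; simp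
  · have h1 := le_csSup (dual_bdd hD hp l) ⟨u, hu, rfl⟩
    have hu' : -u ∈ {u : Euc n | fNorm D p u = 1} := by
      change fNorm D p (-u) = 1
      rw [fN_neg hD hp]; exact hu
    have h2 := le_csSup (dual_bdd hD hp l) ⟨-u, hu', rfl⟩
    simp only [map_neg] at h1 h2
    linarith

lemma dual_le (hD : GoodD D) {p : Euc n} (hp : p ∈ D) (l : Euc n →L[ℝ] ℝ) (u : Euc n) :
    l u ≤ dualNorm D p l * fNorm D p u := by
  by_cases hu : u = 0
  · subst hu; simp [fN_zero]
  · have hN := fN_pos hD hp hu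
    have h1 : fNorm D p ((fNorm D p u)⁻¹ • u) = 1 := by
      rw [fN_smul hD hp (by positivity)]; field_simp
    have h2 := le_csSup (dual_bdd hD hp l) ⟨_, h1, rfl⟩
    simp only [map_smul, smul_eq_mul] at h2
    change _ ≤ dualNorm D p l at h2
    rw [inv_mul_le_iff₀ hN] at h2
    linarith

lemma dual_le_iff (hD : GoodD D) {p : Euc n} (hp : p ∈ D) (l : Euc n →L[ℝ] ℝ) {c : ℝ} (hc : 0 ≤ c) :
    dualNorm D p l ≤ c ↔ ∀ k, l (TopologicalSpace.denseSeq (Euc n) k) ≤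
      c * fNorm D p (TopologicalSpace.denseSeq (Euc n) k) := by
  constructor
  · intro h k
    refine (dual_le hD hp l _).trans ?_
    have := fN_nonneg hD hp (TopologicalSpace.denseSeq (Euc n) k)
    gcongr
  · intro h
    have h1 : ∀ u, l u ≤ c * fNorm D p u := by
      have hcl : IsClosed {u | l u ≤ c * fNorm D p u} :=
        isClosed_le l.continuous (continuous_const.mul (fN_cont hD hp))
      intro u
      have := (TopologicalSpace.denseRange_denseSeq (Euc n)) u
      exact hcl.closure_subset_iff.2 (by rintro _ ⟨k, rfl⟩; exact h k) this
    apply Real.sSup_le _ hc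
    rintro _ ⟨u, hu : fNorm D p u = 1, rfl⟩
    have := h1 u
    rw [hu, mul_one] at this
    exact this

lemma dual_bound (hD : GoodD D) : ∃ M : ℝ, 0 < M ∧ ∀ p ∈ D, ∀ l : Euc n →L[ℝ] ℝ,
    dualNorm D p l ≤ M * ‖l‖ := by
  obtain ⟨M, hM, h⟩ := fN_bound hD
  refine ⟨M, hM, fun p hp l => ?_⟩
  apply Real.sSup_le _ (by positivity)
  rintro _ ⟨u, hu : fNorm D p u = 1, rfl⟩
  have h1 := h p hp u
  rw [hu, mul_one] at h1
  refine ((le_abs_self _).trans (l.le_opNorm u)).trans ?_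
  rw [mul_comm]; gcongr

open Classical in
noncomputable def dm (D : Set (Euc n)) (f : Euc n → ℝ) (p : Euc n) : ℝ :=
  if p ∈ D then dualNorm D p (fderiv ℝ f p) else 0

lemma dm_meas (hD : GoodD D) (f : Euc n → ℝ) : Measurable (dm D f) := by
  refine measurable_of_Iic fun c => ?_
  have hDm : MeasurableSet D := hD.opn.measurableSet
  by_cases hc : 0 ≤ c
  · have : dm D f ⁻¹' Iic c = Dᶜ ∪ (D ∩ ⋂ k, {p | fderiv ℝ f p (TopologicalSpace.denseSeq (Euc n) k) ≤
      c * Fm D (p, (TopologicalSpace.denseSeq (Euc n) k))}) := by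
      ext p
      simp only [dm, mem_preimage, mem_Iic, mem_union, mem_compl_iff, mem_inter_iff, mem_iInter,
        mem_ofPred_eq]
      by_cases hp : p ∈ D
      · simp [hp, dual_le_iff hD hp _ hc, Fm_eq hD hp]
      · simp [hp, hc]
    rw [this]
    refine hDm.compl.union (hDm.inter (MeasurableSet.iInter fun k => measurableSet_le ?_ ?_))
    · exact measurable_fderiv_apply_const ℝ f _
    · have := Fm_meas hD
      fun_prop
  · have : dm D f ⁻¹' Iic c = ∅ := by
      ext p
      simp only [dm, mem_preimage, mem_Iic, mem_empty_iff_false, iff_false, not_le]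
      push Not at hc
      split_ifs with hp
      · exact hc.trans_le (dual_nonneg hD hp _)
      · exact hc
    rw [this]; exact MeasurableSet.empty

noncomputable def rhom (D : Set (Euc n)) (p : Euc n) : ℝ≥0∞ :=
  ENNReal.ofReal (omegaVol n / (Am D p).toReal)

lemma rhom_meas (hD : GoodD D) : Measurable (rhom D) := by
  have := Am_meas hD
  unfold rhom
  fun_prop

lemma omegaVol_pos (n : ℕ) : 0 < omegaVol n := by
  apply ENNReal.toReal_pos
  · exact (Metric.measure_ball_pos _ _ one_pos).ne'
  · exact measure_ball_lt_top.ne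

lemma rhom_pos (hD : GoodD D) {p : Euc n} (hp : p ∈ D) : 0 < rhom D p := by
  unfold rhom
  rw [ENNReal.ofReal_pos]
  exact div_pos (omegaVol_pos n) (ENNReal.toReal_pos (Am_pos hD hp).ne' (Am_lt_top hD hp).ne)

lemma hMeasure_eq (hD : GoodD D) : hMeasure D = (volume.restrict D).withDensity (rhom D) := by
  unfold hMeasure
  refine withDensity_congr_ae ?_
  filter_upwards [ae_restrict_mem hD.opn.measurableSet] with p hp
  rw [rhom, Am_eq hD hp]

lemma hlint (hD : GoodD D) {h : Euc n → ℝ≥0∞} (hh : Measurable h) :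
    ∫⁻ p in D, h p ∂hMeasure D = ∫⁻ p in D, rhom D p * h p := by
  rw [hMeasure_eq hD, restrict_withDensity hD.opn.measurableSet,
    Measure.restrict_restrict hD.opn.measurableSet, inter_self,
    lintegral_withDensity_eq_lintegral_mul _ (rhom_meas hD) hh]
  rfl

end

lemma exists_o {D : Set (Euc 2)} (hD : GoodD D) (hne : D.Nonempty) :
    ∃ o ∈ closure D, ∀ p ∈ D, o 0 < p 0 := by
  have hc : IsCompact (closure D) := hD.bdd.isCompact_closure
  have hcont : Continuous (fun p : Euc 2 => p 0) := by fun_prop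
  obtain ⟨o, ho, hmin⟩ := hc.exists_isMinOn hne.closure hcont.continuousOn
  refine ⟨o, ho, fun p hp => lt_of_le_of_ne (hmin (subset_closure hp)) fun heq => ?_⟩
  have hcts : Continuous (fun t : ℝ => p + t • (!₂[1, 0] : Euc 2)) := by fun_prop
  have hop : IsOpen {t : ℝ | p + t • (!₂[1, 0] : Euc 2) ∈ D} := hD.opn.preimage hcts
  have h0 : (0:ℝ) ∈ {t : ℝ | p + t • (!₂[1, 0] : Euc 2) ∈ D} := by simpa using hp
  obtain ⟨ε, hε, hb⟩ := Metric.isOpen_iff.1 hop 0 h0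
  have h1 : (-(ε/2)) ∈ Metric.ball (0:ℝ) ε := by
    rw [mem_ball_zero_iff, Real.norm_eq_abs, abs_neg, abs_of_pos (by linarith)]; linarith
  have h2 : o 0 ≤ (p + (-(ε/2)) • (!₂[1, 0] : Euc 2)) 0 := hmin (subset_closure (hb h1))
  simp at h2
  linarith

lemma ray_set {D : Set (Euc 2)} (hD : GoodD D) {o : Euc 2} (ho : o ∈ closure D)
    (hlt : ∀ p ∈ D, o 0 < p 0) {y x₀ : ℝ} (hx₀ : o + x₀ • (!₂[1, y] : Euc 2) ∈ D) :
    ∃ R : ℝ, 0 < R ∧ ∀ x : ℝ, o + x • (!₂[1, y] : Euc 2) ∈ D ↔ x ∈ Ioo 0 R := by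
  have hlp := lineParams_eq hD hx₀ (e_ne y)
  set e : Euc 2 := !₂[1, y] with he
  set p := o + x₀ • e with hp
  set A := (gg D p (-e))⁻¹
  set B := (gg D p e)⁻¹
  have hB : 0 < B := inv_pos.2 (gg_pos hD hx₀ (e_ne y))
  have hset : ∀ x : ℝ, o + x • e ∈ D ↔ x ∈ Ioo (x₀ - A) (x₀ + B) := by
    intro x
    have : x - x₀ ∈ lineParams D p e ↔ x - x₀ ∈ Ioo (-A) B := by rw [hlp]
    have e1 : p + (x - x₀) • e = o + x • e := by rw [hp, sub_smul]; abel
    change p + (x - x₀) • e ∈ D ↔ _ at this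
    rw [e1] at this
    rw [this, mem_Ioo, mem_Ioo]
    constructor <;> rintro ⟨h1, h2⟩ <;> constructor <;> linarith
  have pos : ∀ x : ℝ, o + x • e ∈ D → 0 < x := by
    intro x hx
    have := hlt _ hx
    simp [he] at this
    exact this
  have hx0 : 0 < x₀ := pos x₀ hx₀
  have hAx : x₀ - A = 0 := by
    apply le_antisymm
    · by_contra hcon
      push Not at hcon
      have hx1 : o + (min (x₀ - A) x₀ / 2) • e ∈ D := by
        have hm : 0 < min (x₀ - A) x₀ := lt_min hcon hx0
        set s := min (x₀ - A) x₀ / 2 with hs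
        have hsx : s < x₀ := by
          have := min_le_right (x₀ - A) x₀
          linarith
        have := hD.cvx.combo_closure_interior_mem_interior ho (hD.opn.interior_eq.symm ▸ hx₀ : p ∈ interior D)
          (a := 1 - s / x₀) (b := s / x₀) (by rw [sub_nonneg, div_le_one hx0]; exact hsx.le)
          (by positivity) (by ring)
        rw [hD.opn.interior_eq] at this
        convert this using 1
        rw [hp, smul_add, smul_smul, div_mul_cancel₀ _ hx0.ne', ← add_assoc, ← add_smul]
        simp
      have := ((hset _).1 hx1).1
      have h3 := min_le_left (x₀ - A) x₀
      linarith
    · by_contra hcon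
      push Not at hcon
      have h1 := (hset 0).2 ⟨hcon, by linarith⟩
      exact lt_irrefl _ (pos 0 h1)
  refine ⟨x₀ + B, by linarith, fun x => ?_⟩
  rw [hset, hAx]

lemma fN_ray {D : Set (Euc 2)} {o : Euc 2} {y R : ℝ}
    (hR : ∀ x : ℝ, o + x • (!₂[1, y] : Euc 2) ∈ D ↔ x ∈ Ioo 0 R) {x : ℝ} (hx : x ∈ Ioo 0 R) :
    fNorm D (o + x • !₂[1, y]) !₂[1, y] = psi R x := by
  have hlp : lineParams D (o + x • !₂[1, y]) !₂[1, y] = Ioo (-x) (R - x) := by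
    ext t
    have e1 : (o + x • !₂[1, y] : Euc 2) + t • !₂[1, y] = o + (x + t) • !₂[1, y] := by
      rw [add_smul]; abel
    change _ ∈ D ↔ _
    rw [e1, hR, mem_Ioo, mem_Ioo]
    constructor <;> rintro ⟨h1, h2⟩ <;> constructor <;> linarith
  have h1 := hx.1
  have h2 := hx.2
  have h3 : R - x ≠ 0 := by linarith
  unfold fNorm
  rw [if_neg (e_ne y), hlp, csSup_Ioo (by linarith), csInf_Ioo (by linarith), psi]
  field_simp
  ring

lemma H_decay {D : Set (Euc 2)} (hD : GoodD D) {δ : ℝ} (hδ : 0 ≤ δ) (hyp : IsDeltaHyp D δ)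
    {o : Euc 2} (ho : o ∈ closure D) {y R : ℝ}
    (hR : ∀ x : ℝ, o + x • (!₂[1, y] : Euc 2) ∈ D ↔ x ∈ Ioo 0 R) {x x' : ℝ} (hx : x ∈ Ioo 0 R)
    (hx' : x' ∈ Ioo 0 R) (hxx : x ≤ x') :
    ENNReal.ofReal (x / psi R x) * rhom D (o + x • !₂[1, y]) ≤
    ENNReal.ofReal (4 * (VV R x / VV R x') ^ (2 * ((((Lam δ) ^ 2)⁻¹) / 4))) *
     (ENNReal.ofReal (x' / psi R x') * rhom D (o + x' • !₂[1, y])) := by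
  have hp := (hR x).2 hx
  have hp' := (hR x').2 hx'
  have hψ := psi_pos hx
  have hψ' := psi_pos hx'
  have x0 := hx.1
  have x0' := hx'.1
  obtain ⟨w, hw⟩ := exists_isW hD hp (alph_ne y)
  obtain ⟨w', hw'⟩ := exists_isW hD hp' (alph_ne y)
  have w0 := hw.1
  have w0' := hw'.1
  have key := width_mult hD hδ hyp ho (fun x h1 h2 => (hR x).2 ⟨h1, h2⟩)
    (fun h => lt_irrefl _ ((hR R).1 h).2) (alph_ne y) (alph_e y) hx.1 hxx hx'.2 hw hw'
  change w' / x' ≤ w / x * (VV R x / VV R x') ^ _ at key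
  have e2 : 2 * ((((Lam δ) ^ 2)⁻¹) / 4) = (((Lam δ) ^ 2)⁻¹) / 2 := by ring
  rw [e2]
  set q := (VV R x / VV R x') ^ ((((Lam δ) ^ 2)⁻¹) / 2) with hq
  have q0 : 0 < q := Real.rpow_pos_of_pos (div_pos (VV_pos hx) (VV_pos hx')) _
  have aL := area_lower hD hp hw
  have aU := area_upper hD hp' hw'
  rw [fN_ray hR hx, ← Am_eq hD hp] at aL
  rw [fN_ray hR hx', ← Am_eq hD hp'] at aU
  have aL' := (ENNReal.ofReal_le_iff_le_toReal (Am_lt_top hD hp).ne).1 aL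
  have aU' := (ENNReal.toReal_le_of_le_ofReal (by positivity) aU)
  have A0 : 0 < (Am D (o + x • !₂[1, y])).toReal :=
    ENNReal.toReal_pos (Am_pos hD hp).ne' (Am_lt_top hD hp).ne
  have A0' : 0 < (Am D (o + x' • !₂[1, y])).toReal :=
    ENNReal.toReal_pos (Am_pos hD hp').ne' (Am_lt_top hD hp').ne
  unfold rhom
  set A := (Am D (o + x • !₂[1, y])).toReal
  set A' := (Am D (o + x' • !₂[1, y])).toReal
  have om := omegaVol_pos 2
  rw [← ENNReal.ofReal_mul (by positivity), ← ENNReal.ofReal_mul (by positivity),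
    ← ENNReal.ofReal_mul (by positivity)]
  apply ENNReal.ofReal_le_ofReal
  calc x / psi R x * (omegaVol 2 / A) ≤ x / psi R x * (omegaVol 2 / ((psi R x)⁻¹ * w)) := by gcongr
    _ = omegaVol 2 * (x / w) := by field_simp
    _ ≤ omegaVol 2 * (q * (x' / w')) := by
        gcongr
        rw [div_le_iff₀ x0'] at key
        rw [div_le_iff₀ w0]
        calc x = x * w' / w' := by field_simp
          _ ≤ x * (w / x * q * x') / w' := by gcongr
          _ = _ := by field_simp
    _ = 4 * q * (x' / psi R x' * (omegaVol 2 / (4 * ((psi R x')⁻¹ * w')))) := by field_simp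
    _ ≤ _ := by gcongr

lemma ae_ray {N : Set (Euc 2)} (hNm : MeasurableSet N) (hN : volume N = 0) (o : Euc 2) :
    ∀ᵐ y : ℝ, ∀ᵐ x ∂(volume.restrict (Ioi (0:ℝ))), o + x • (!₂[1, y] : Euc 2) ∉ N := by
  set F : Euc 2 → ℝ≥0∞ := (N ∩ {p | o 0 < p 0}).indicator 1 with hF
  have hm : MeasurableSet (N ∩ {p : Euc 2 | o 0 < p 0}) :=
    hNm.inter (measurableSet_lt measurable_const (by fun_prop))
  have hFm : Measurable F := measurable_one.indicator hm
  have h1 := lint_polar hFm o (fun p hp => indicator_of_notMem (fun h => not_lt.2 hp h.2) _)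
  have h2 : ∫⁻ p, F p = 0 := by
    rw [hF, lintegral_indicator_one hm]
    exact measure_mono_null inter_subset_left hN
  have hG2 : Measurable (fun q : ℝ × ℝ => ENNReal.ofReal q.2 * F (o + q.2 • !₂[1, q.1])) := by
    refine Measurable.mul (by fun_prop) (hFm.comp (measurable_const.add (Measurable.smul measurable_snd ?_)))
    exact meas_mk2.comp (by fun_prop : Measurable fun q : ℝ × ℝ => ((1:ℝ), q.1))
  rw [h2] at h1
  have h3 := (lintegral_eq_zero_iff (Measurable.lintegral_prod_right' (ν := volume.restrict (Ioi (0:ℝ))) hG2)).1 h1.symm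
  filter_upwards [h3] with y hy
  have h4 := (lintegral_eq_zero_iff (hG2.comp measurable_prodMk_left)).1 hy
  filter_upwards [h4, ae_restrict_mem measurableSet_Ioi] with x hx hx0 hmem
  have hx0' : 0 < x := hx0
  simp only [Function.comp, Pi.zero_apply, mul_eq_zero, ENNReal.ofReal_eq_zero, not_le.2 hx0',
    false_or] at hx
  have hmem2 : o + x • (!₂[1, y] : Euc 2) ∈ N ∩ {p : Euc 2 | o 0 < p 0} := ⟨hmem, by simp [hx0']⟩
  rw [hF, indicator_of_mem hmem2] at hx
  simp at hx

lemma master {D : Set (Euc 2)} (hD : GoodD D) (hne : D.Nonempty) {δ : ℝ} (hδ : 0 ≤ δ)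
    (hyp : IsDeltaHyp D δ) {f : Euc 2 → ℝ} {K : ℝ≥0} (hf : LipschitzWith K f)
    (hf0 : ∀ p, p ∉ D → f p = 0) :
    ∫⁻ p in D, rhom D p * ENNReal.ofReal (f p ^ 2) ≤
      ENNReal.ofReal (((((Lam δ) ^ 2)⁻¹ / 4) ^ 2)⁻¹) *
        ∫⁻ p in D, rhom D p * ENNReal.ofReal (dm D f p ^ 2) := by
  obtain ⟨o, ho, hlt⟩ := exists_o hD hne
  have hDm := hD.opn.measurableSet
  have hρ := rhom_meas hD
  have hfm : Measurable f := hf.continuous.measurable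
  have hdm := dm_meas hD f
  set a := ((Lam δ) ^ 2)⁻¹ / 4 with ha
  have ha0 : 0 < a := by
    have := one_lt_Lam hδ
    positivity
  set N : Set (Euc 2) := {p | DifferentiableAt ℝ f p}ᶜ with hN
  have hNm : MeasurableSet N := (measurableSet_of_differentiableAt ℝ f).compl
  have hN0 : volume N = 0 := hf.ae_differentiableAt
  rw [← lintegral_indicator hDm, ← lintegral_indicator hDm]
  rw [lint_polar ((by fun_prop : Measurable _).indicator hDm) o
      (fun p hp => indicator_of_notMem (fun h => not_lt.2 hp (hlt p h)) _),
    lint_polar ((by fun_prop : Measurable _).indicator hDm) o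
      (fun p hp => indicator_of_notMem (fun h => not_lt.2 hp (hlt p h)) _),
    ← lintegral_const_mul' _ _ ENNReal.ofReal_ne_top]
  refine lintegral_mono_ae ?_
  filter_upwards [ae_ray hNm hN0 o] with y hy
  by_cases hex : ∃ x₀ : ℝ, o + x₀ • (!₂[1, y] : Euc 2) ∈ D
  swap
  · push Not at hex
    have : ∀ x : ℝ, ENNReal.ofReal x *
        D.indicator (fun p => rhom D p * ENNReal.ofReal (f p ^ 2)) (o + x • !₂[1, y]) = 0 := by
      intro x
      rw [indicator_of_notMem (hex x), mul_zero]
    simp [this]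
  obtain ⟨x₀, hx₀⟩ := hex
  obtain ⟨R, hR0, hR⟩ := ray_set hD ho hlt hx₀
  set e : Euc 2 := !₂[1, y] with he
  set g : ℝ → ℝ := fun x => f (o + x • e) with hg
  have hgl : LipschitzWith (K * ‖e‖₊) g := by
    refine LipschitzWith.of_dist_le_mul fun s t => ?_
    refine (hf.dist_le_mul _ _).trans (le_of_eq ?_)
    rw [dist_add_left, dist_eq_norm, ← sub_smul, norm_smul, Real.dist_eq]
    push_cast
    rw [Real.norm_eq_abs]; ring
  have hgR : g R = 0 := hf0 _ (fun h => lt_irrefl _ ((hR R).1 h).2)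
  have hHm : Measurable (fun x => ENNReal.ofReal (x / psi R x) * rhom D (o + x • e)) := by
    have := psi_meas R
    fun_prop
  have hh := hardy ha0 hgl hgR hHm (fun x hx x' hx' hxx => H_decay hD hδ hyp ho hR hx hx' hxx)
  have conv : ∀ F : Euc 2 → ℝ≥0∞, ∫⁻ x in Ioi (0:ℝ), ENNReal.ofReal x * D.indicator F (o + x • e) =
      ∫⁻ x in Ioo 0 R, ENNReal.ofReal x * F (o + x • e) := by
    intro F
    rw [← lintegral_indicator measurableSet_Ioi, ← lintegral_indicator measurableSet_Ioo]
    refine lintegral_congr fun x => ?_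
    by_cases hx : x ∈ Ioo 0 R
    · rw [indicator_of_mem hx, indicator_of_mem (mem_Ioi.2 hx.1), indicator_of_mem ((hR x).2 hx)]
    · rw [indicator_of_notMem hx]
      by_cases hx1 : x ∈ Ioi 0
      · rw [indicator_of_mem hx1, indicator_of_notMem (fun h => hx ((hR x).1 h)), mul_zero]
      · rw [indicator_of_notMem hx1]
  rw [conv, conv]
  calc _ = ∫⁻ x in Ioo 0 R, ENNReal.ofReal (g x ^ 2 * psi R x) *
          (ENNReal.ofReal (x / psi R x) * rhom D (o + x • e)) := by
        refine setLIntegral_congr_fun measurableSet_Ioo fun x hx => ?_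
        have hψ := psi_pos hx
        have := hx.1
        rw [← mul_assoc (ENNReal.ofReal (g x ^ 2 * psi R x)), ← ENNReal.ofReal_mul (by positivity),
          mul_comm (rhom D _), ← mul_assoc, ← ENNReal.ofReal_mul (by positivity)]
        congr 2
        simp only [hg]
        field_simp
    _ ≤ _ := hh
    _ ≤ _ := by
        gcongr 1
        refine lintegral_mono_ae ?_
        have hy2 := ae_mono (Measure.restrict_mono (Ioo_subset_Ioi_self : Ioo 0 R ⊆ Ioi 0) le_rfl) hy
        filter_upwards [hy2, ae_restrict_mem measurableSet_Ioo] with x hxN hx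
        have hψ := psi_pos hx
        have hx0 := hx.1
        have hp := (hR x).2 hx
        have hdiff : DifferentiableAt ℝ f (o + x • e) := by
          by_contra hcon; exact hxN hcon
        have hder : deriv g x = fderiv ℝ f (o + x • e) e := by
          have h1 : HasDerivAt (fun x : ℝ => o + x • e) e x := by
            simpa using ((hasDerivAt_id x).smul_const e).const_add o
          exact (hdiff.hasFDerivAt.comp_hasDerivAt x h1).deriv
        have hdme : dm D f (o + x • e) = dualNorm D (o + x • e) (fderiv ℝ f (o + x • e)) := by
          rw [dm, if_pos hp]
        have b1 := dual_le hD hp (fderiv ℝ f (o + x • e)) e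
        have b2 := dual_le hD hp (fderiv ℝ f (o + x • e)) (-e)
        rw [fN_neg hD hp, map_neg] at b2
        rw [fN_ray hR hx, ← hder, ← hdme] at b1 b2
        have b3 : deriv g x ^ 2 ≤ (dm D f (o + x • e) * psi R x) ^ 2 := sq_le_sq' (by linarith) b1
        rw [← mul_assoc, ← ENNReal.ofReal_mul (by positivity), mul_comm (rhom D _), ← mul_assoc,
          ← ENNReal.ofReal_mul (by positivity)]
        refine mul_le_mul_left (ENNReal.ofReal_le_ofReal ?_) _
        calc deriv g x ^ 2 / psi R x * (x / psi R x)
            ≤ (dm D f (o + x • e) * psi R x) ^ 2 / psi R x * (x / psi R x) := by gcongr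
          _ = x * dm D f (o + x • e) ^ 2 := by field_simp

lemma L2_fin {D : Set (Euc 2)} (hD : GoodD D) {f : Euc 2 → ℝ} {K : ℝ≥0} (hf : LipschitzWith K f)
    (hc : HasCompactSupport f) (hs : tsupport f ⊆ D) :
    ∫⁻ p in D, rhom D p * ENNReal.ofReal (dm D f p ^ 2) < ⊤ := by
  have hk : IsCompact (tsupport f) := hc
  obtain ⟨r, hr, hrD⟩ := hk.exists_thickening_subset_open hD.opn hs
  obtain ⟨M, hM, hMd⟩ := dual_bound hD
  set v := volume (Metric.ball (0 : Euc 2) r) with hv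
  have v0 : 0 < v.toReal :=
    ENNReal.toReal_pos (Metric.measure_ball_pos _ _ hr).ne' measure_ball_lt_top.ne
  have om := omegaVol_pos 2
  have hbound : ∀ p ∈ D, rhom D p * ENNReal.ofReal (dm D f p ^ 2) ≤
      (tsupport f).indicator
        (fun _ => ENNReal.ofReal (omegaVol 2 / v.toReal) * ENNReal.ofReal ((M * K) ^ 2)) p := by
    intro p hp
    have hd0 : 0 ≤ dm D f p := by rw [dm, if_pos hp]; exact dual_nonneg hD hp _
    by_cases hps : p ∈ tsupport f
    · rw [indicator_of_mem hps]
      have hin : ∀ u ∈ Metric.ball (0 : Euc 2) r, p + u ∈ D := by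
        intro u hu
        apply hrD
        rw [Metric.mem_thickening_iff]
        refine ⟨p, hps, ?_⟩
        rw [mem_ball_zero_iff] at hu
        simpa [dist_eq_norm] using hu
      have hsub : Metric.ball (0 : Euc 2) r ⊆ tangentBall D p 1 := by
        intro u hu
        change fNorm D p u < 1
        rw [fNorm_eq hD hp]
        have h1 := (gg_lt_one hD hp u).2 (hin u hu)
        have h2 := (gg_lt_one hD hp (-u)).2 (hin (-u) (by simpa using hu))
        linarith
      have hA : v.toReal ≤ (Am D p).toReal := by
        apply ENNReal.toReal_mono (Am_lt_top hD hp).ne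
        rw [Am_eq hD hp]
        exact measure_mono hsub
      unfold rhom
      gcongr
      rw [dm, if_pos hp]
      refine (hMd p hp _).trans ?_
      gcongr
      exact norm_fderiv_le_of_lipschitz ℝ hf
    · have h1 : fderiv ℝ f p = 0 := by
        by_contra hcon
        exact hps (support_fderiv_subset ℝ hcon)
      have h2 := hMd p hp (fderiv ℝ f p)
      rw [h1, norm_zero, mul_zero] at h2
      have h3 : dm D f p = 0 := by
        apply le_antisymm _ hd0
        rw [dm, if_pos hp, h1]; exact h2
      rw [h3]; simp
  calc _ ≤ ∫⁻ p in D, (tsupport f).indicator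
        (fun _ => ENNReal.ofReal (omegaVol 2 / v.toReal) * ENNReal.ofReal ((M * K) ^ 2)) p :=
        setLIntegral_mono' hD.opn.measurableSet hbound
    _ ≤ ∫⁻ p, (tsupport f).indicator
        (fun _ => ENNReal.ofReal (omegaVol 2 / v.toReal) * ENNReal.ofReal ((M * K) ^ 2)) p :=
        setLIntegral_le_lintegral _ _
    _ = (ENNReal.ofReal (omegaVol 2 / v.toReal) * ENNReal.ofReal ((M * K) ^ 2)) *
        volume (tsupport f) := lintegral_indicator_const (isClosed_tsupport f).measurableSet _
    _ < ⊤ := ENNReal.mul_lt_top (ENNReal.mul_lt_top ENNReal.ofReal_lt_top ENNReal.ofReal_lt_top)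
        hk.measure_lt_top

lemma L1_pos {D : Set (Euc 2)} (hD : GoodD D) {f : Euc 2 → ℝ} (hf : Continuous f)
    (hne : f ≠ 0) (hs : tsupport f ⊆ D) :
    0 < ∫⁻ p in D, rhom D p * ENNReal.ofReal (f p ^ 2) := by
  have hρ := rhom_meas hD
  have hfm := hf.measurable
  rw [setLIntegral_pos_iff (by fun_prop)]
  have hop : IsOpen (Function.support f) := hf.isOpen_support
  have hnem : (Function.support f).Nonempty := Function.support_nonempty_iff.2 hne
  refine (hop.measure_pos volume hnem).trans_le (measure_mono fun p hp => ?_)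
  have hpD : p ∈ D := hs (subset_tsupport f hp)
  refine ⟨?_, hpD⟩
  rw [Function.mem_support]
  have h1 := (rhom_pos hD hpD).ne'
  have h2 : f p ≠ 0 := hp
  have h3 : ENNReal.ofReal (f p ^ 2) ≠ 0 := by
    rw [Ne, ENNReal.ofReal_eq_zero, not_le]; positivity
  exact mul_ne_zero h1 h3

lemma lambda_lower {D : Set (Euc 2)} (hD : GoodD D) (hne : D.Nonempty) {δ : ℝ} (hδ : 0 ≤ δ)
    (hyp : IsDeltaHyp D δ) : ((((Lam δ) ^ 2)⁻¹ / 4) ^ 2) ≤ lambda1 D := by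
  have hLam := one_lt_Lam hδ
  set b := ((((Lam δ) ^ 2)⁻¹ / 4) ^ 2) with hb
  have b0 : 0 < b := by positivity
  have hDm := hD.opn.measurableSet
  unfold lambda1 lambda1D
  apply le_csInf
  · apply Set.Nonempty.image
    obtain ⟨p, hp⟩ := hne
    obtain ⟨r, hr, hrD⟩ := Metric.isOpen_iff.1 hD.opn p hp
    have hlip : LipschitzWith 1 (fun z : Euc 2 => max (r / 2 - dist z p) 0) := by
      refine LipschitzWith.max_const ?_ 0
      refine LipschitzWith.of_dist_le_mul fun s t => ?_
      rw [Real.dist_eq]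
      have := abs_dist_sub_le s t p
      rw [show r / 2 - dist s p - (r / 2 - dist t p) = -(dist s p - dist t p) by ring, abs_neg]
      simpa using this
    have hsup : tsupport (fun z : Euc 2 => max (r / 2 - dist z p) 0) ⊆ Metric.closedBall p (r / 2) := by
      apply closure_minimal _ Metric.isClosed_closedBall
      intro z hz
      by_contra hcon
      apply hz
      rw [Metric.mem_closedBall, not_le] at hcon
      simp only
      rw [max_eq_right]; linarith
    refine ⟨_, ⟨1, hlip⟩, ?_, ?_, hsup.trans ((Metric.closedBall_subset_ball (by linarith)).trans hrD)⟩
    · intro h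
      have := congrFun h p
      simp at this
      linarith
    · exact (isCompact_closedBall p (r / 2)).of_isClosed_subset (isClosed_tsupport _) hsup
  · rintro _ ⟨f, ⟨⟨K, hf⟩, hf0, hc, hs⟩, rfl⟩
    have hfz : ∀ p, p ∉ D → f p = 0 := fun p hp => image_eq_zero_of_notMem_tsupport fun h => hp (hs h)
    have hm := master hD hne hδ hyp hf hfz
    have hfin := L2_fin hD hf hc hs
    have hpos := L1_pos hD hf.continuous hf0 hs
    have hfm := hf.continuous.measurable
    have hdm := dm_meas hD f
    set L1 := ∫⁻ p in D, rhom D p * ENNReal.ofReal (f p ^ 2) with hL1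
    set L2 := ∫⁻ p in D, rhom D p * ENNReal.ofReal (dm D f p ^ 2) with hL2
    have I1 : ∫ p in D, f p ^ 2 ∂hMeasure D = L1.toReal := by
      rw [integral_eq_lintegral_of_nonneg_ae (ae_of_all _ fun p => sq_nonneg _)
        (by fun_prop), hlint hD (by fun_prop)]
    have I2 : ∫ p in D, dualNorm D p (fderiv ℝ f p) ^ 2 ∂hMeasure D = L2.toReal := by
      have : ∫ p in D, dualNorm D p (fderiv ℝ f p) ^ 2 ∂hMeasure D =
          ∫ p in D, dm D f p ^ 2 ∂hMeasure D := by
        refine setIntegral_congr_fun hDm fun p hp => ?_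
        simp only [dm, if_pos hp]
      rw [this, integral_eq_lintegral_of_nonneg_ae (ae_of_all _ fun p => sq_nonneg _)
        (by fun_prop), hlint hD (by fun_prop)]
    unfold rayleigh
    rw [I1, I2]
    have hrhs : ENNReal.ofReal b⁻¹ * L2 < ⊤ := ENNReal.mul_lt_top ENNReal.ofReal_lt_top hfin
    have hL1fin : L1 < ⊤ := hm.trans_lt hrhs
    have h1 := ENNReal.toReal_mono hrhs.ne hm
    rw [ENNReal.toReal_mul, ENNReal.toReal_ofReal (by positivity)] at h1
    rw [le_div_iff₀ (ENNReal.toReal_pos hpos.ne' hL1fin.ne)]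
    rw [inv_mul_eq_div, le_div_iff₀ b0] at h1
    linarith

lemma good_pre {n : ℕ} {C : Set (Euc n)} (h1 : Convex ℝ C) (h2 : IsOpen C)
    (h3 : Bornology.IsBounded C) (φ : Euc 2 →ᵃⁱ[ℝ] Euc n) : GoodD (φ ⁻¹' C) where
  cvx := h1.affine_preimage φ.toAffineMap
  opn := h2.preimage φ.continuous
  bdd := φ.isometry.antilipschitz.isBounded_preimage h3

lemma hDist_pre {n : ℕ} (C : Set (Euc n)) (φ : Euc 2 →ᵃⁱ[ℝ] Euc n) (p q : Euc 2) :
    hDist (φ ⁻¹' C) p q = hDist C (φ p) (φ q) := by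
  have h : lineParams (φ ⁻¹' C) p (q - p) = lineParams C (φ p) (φ q - φ p) := by
    ext t
    have : φ (p + t • (q - p)) = φ p + t • (φ q - φ p) := by
      have e1 : φ q - φ p = φ.linearIsometry (q - p) := by
        have := φ.map_vsub q p
        simpa using this.symm
      have e2 := φ.map_vadd p (t • (q - p))
      simp only [vadd_eq_add, map_smul] at e2
      rw [e1, add_comm p, e2, add_comm]
    change φ (p + t • (q - p)) ∈ C ↔ φ p + t • (φ q - φ p) ∈ C
    rw [this]
  unfold hDist
  rw [h]
  simp only [φ.injective.eq_iff]

lemma hyp_pre {n : ℕ} {C : Set (Euc n)} {δ : ℝ} (h : IsDeltaHyp C δ) (φ : Euc 2 →ᵃⁱ[ℝ] Euc n) :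
    IsDeltaHyp (φ ⁻¹' C) δ := by
  intro x hx y hy z hz t ht
  have := h _ hx _ hy _ hz _ ht
  simpa only [gromovProd, hDist_pre] using this

/-- for every `δ ≥ 0` there exists `λ > 0` such that for every bounded
open convex `C ⊆ ℝⁿ` whose Hilbert metric is `δ`-hyperbolic, every planar section of
`C` satisfies `λ₁(C ∩ H) ≥ λ`. -/
theorem stmt8 {n : ℕ} (δ : ℝ) (hδ : 0 ≤ δ) :
    ∃ lam : ℝ, 0 < lam ∧ ∀ C : Set (Euc n), Convex ℝ C → IsOpen C →
      Bornology.IsBounded C → C.Nonempty → IsDeltaHyp C δ →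
      ∀ φ : Euc 2 →ᵃⁱ[ℝ] Euc n, (φ ⁻¹' C).Nonempty → lambda1 (φ ⁻¹' C) ≥ lam := by
  have hLam := one_lt_Lam hδ
  refine ⟨(((Lam δ) ^ 2)⁻¹ / 4) ^ 2, by positivity, fun C h1 h2 h3 _ h5 φ hne => ?_⟩
  exact lambda_lower (good_pre h1 h2 h3 φ) hne hδ (hyp_pre h5 φ)
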